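/- arXiv:0711.3136 — 4 statements merged into one kernel-verified Lean document; each statement's English description precedes it below -/
import Mathlib

section
/- Let μ be a probability measure on {0,1}^E (E finite) satisfying the positive lattice condition. Then μ is positively associated: for any two increasing events A, B ⊆ {0,1}^E, μ(A∩B) ≥ μ(A)μ(B). In particular, every random cluster measure φ_{p,q} with q ≥ 1 is positively associated. -/
open Finset
open scoped Classical
open scoped FinsetFamily

/-- The FKG inequality: a probability measure on `{0,1}^E` satisfying the positive
lattice condition is positively associated. -/
theorem stmt_6 {E : Type*} [Fintype E] [DecidableEq E] (μ : (E → Bool) → ℝ)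
    (hnn : ∀ η, 0 ≤ μ η) (hsum : ∑ η, μ η = 1)
    (hplc : ∀ η τ : E → Bool, μ η * μ τ ≤ μ (η ⊓ τ) * μ (η ⊔ τ))
    (A B : Set (E → Bool))
    (hA : ∀ η τ : E → Bool, η ≤ τ → η ∈ A → τ ∈ A)
    (hB : ∀ η τ : E → Bool, η ≤ τ → η ∈ B → τ ∈ B) :
    (∑ η ∈ Finset.univ.filter (fun η : E → Bool => η ∈ A ∩ B), μ η) ≥
      (∑ η ∈ Finset.univ.filter (fun η : E → Bool => η ∈ A), μ η) *
        (∑ η ∈ Finset.univ.filter (fun η : E → Bool => η ∈ B), μ η) := by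
  have h := four_functions_theorem μ μ μ μ hnn hnn hnn hnn hplc
    (univ.filter fun η : E → Bool => η ∈ A) (univ.filter fun η : E → Bool => η ∈ B)
  refine h.trans ?_
  have hinf : ∑ η ∈ (univ.filter fun η : E → Bool => η ∈ A) ⊼
      (univ.filter fun η : E → Bool => η ∈ B), μ η ≤ 1 :=
    hsum ▸ sum_le_sum_of_subset_of_nonneg (subset_univ _) fun η _ _ => hnn η
  refine (mul_le_of_le_one_left (sum_nonneg fun η _ => hnn η) hinf).trans
    (sum_le_sum_of_subset_of_nonneg ?_ fun η _ _ => hnn η)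
  intro η hη
  obtain ⟨a, ha, b, hb, rfl⟩ := mem_sups.1 hη
  exact mem_filter.2 ⟨mem_univ _, hA a _ le_sup_left (mem_filter.1 ha).2,
    hB b _ le_sup_right (mem_filter.1 hb).2⟩
end

section
/- Let G = (V,E) be a finite graph, η a random subgraph with distribution φ_{p,q} (q ≥ 1), and σ ∈ {±1}^V the fractional fuzzy Potts configuration obtained by assigning to each cluster of η independently the spin +1 with probability α ∈ (0,1) and −1 otherwise. Then σ is positively associated: for any two increasing events A, B on {±1}^V, ν(A∩B) ≥ ν(A)ν(B), where ν is the law of σ. -/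
open Finset
open scoped Classical

def openSub {V E : Type*} (ends : E → Sym2 V) (η : E → Bool) : SimpleGraph V :=
  SimpleGraph.fromEdgeSet {s | ∃ f, η f = true ∧ ends f = s}

noncomputable def numComp {V E : Type*} (ends : E → Sym2 V) (η : E → Bool) : ℕ :=
  Nat.card (openSub ends η).ConnectedComponent

noncomputable def rcWeight {V E : Type*} [Fintype E] (ends : E → Sym2 V)
    (p : E → ℝ) (q : ℝ) (η : E → Bool) : ℝ :=
  (∏ f, if η f then p f else 1 - p f) * q ^ numComp ends η

noncomputable def rcMeasure {V E : Type*} [Fintype V] [Fintype E] [DecidableEq E]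
    (ends : E → Sym2 V) (p : E → ℝ) (q : ℝ) (η : E → Bool) : ℝ :=
  rcWeight ends p q η / ∑ τ : E → Bool, rcWeight ends p q τ

/-- Probability that i.i.d. Bernoulli(α) cluster spins for the open subgraph of `η`
produce the spin configuration `σ` (`true` = spin +1, `false` = spin −1). -/
noncomputable def colorWeight {V E : Type*} (ends : E → Sym2 V) (α : ℝ)
    (η : E → Bool) (σ : V → Bool) : ℝ :=
  if ∀ u v : V, (openSub ends η).Reachable u v → σ u = σ v then
    α ^ Nat.card {K : (openSub ends η).ConnectedComponent //
        ∃ v, (openSub ends η).connectedComponentMk v = K ∧ σ v = true} *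
      (1 - α) ^ Nat.card {K : (openSub ends η).ConnectedComponent //
        ∃ v, (openSub ends η).connectedComponentMk v = K ∧ σ v = false}
  else 0

/-- The fractional fuzzy Potts measure `ν_{φ,α}` built from the random-cluster
measure `φ_{p,q}`. -/
noncomputable def ffpMeasure {V E : Type*} [Fintype V] [Fintype E] [DecidableEq E]
    (ends : E → Sym2 V) (p : E → ℝ) (q α : ℝ) (σ : V → Bool) : ℝ :=
  ∑ η : E → Bool, rcMeasure ends p q η * colorWeight ends α η σ

section BernoulliProduct

/-- Expectation of `h` under i.i.d. Bernoulli(`α`) colors indexed by `ι`. -/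
noncomputable def bernExp {ι : Type*} [Fintype ι] [DecidableEq ι] (α : ℝ) (h : (ι → Bool) → ℝ) : ℝ :=
  ∑ c : ι → Bool, (∏ i, if c i then α else 1 - α) * h c

variable {ι : Type*} [Fintype ι] [DecidableEq ι] {α : ℝ}

theorem bernExp_mono (h0 : 0 ≤ α) (h1 : α ≤ 1) {h h' : (ι → Bool) → ℝ} (hh : ∀ c, h c ≤ h' c) :
    bernExp α h ≤ bernExp α h' := by
  refine Finset.sum_le_sum fun c _ => mul_le_mul_of_nonneg_left (hh c) ?_
  refine Finset.prod_nonneg fun i _ => ?_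
  split_ifs <;> linarith

theorem bernExp_const (a : ℝ) : bernExp α (fun _ : ι → Bool => a) = a := by
  have h := Finset.prod_univ_sum (fun _ : ι => (Finset.univ : Finset Bool))
    (fun _ b => if b then α else 1 - α)
  simp only [Fintype.sum_bool, Fintype.piFinset_univ] at h
  rw [bernExp, ← Finset.sum_mul, ← h]
  simp

theorem bernExp_not (h : (ι → Bool) → ℝ) :
    bernExp α h = bernExp (1 - α) (fun c => h (fun i => !c i)) := by
  refine Fintype.sum_equiv (Equiv.arrowCongr (Equiv.refl ι) Equiv.boolNot) _ _ fun c => ?_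
  congr 1
  · refine Finset.prod_congr rfl fun i _ => ?_
    cases hc : c i <;> simp [Equiv.arrowCongr, hc]
  · congr 1
    funext i
    simp [Equiv.arrowCongr]

/-- Conditioning on the color of a single index. -/
theorem bernExp_split (i : ι) (h : (ι → Bool) → ℝ) (g₁ g₀ : (ι → Bool) → ℝ)
    (hg₁ : ∀ c b, g₁ (Function.update c i b) = g₁ c)
    (hg₀ : ∀ c b, g₀ (Function.update c i b) = g₀ c)
    (h₁ : ∀ c, c i = true → h c = g₁ c) (h₀ : ∀ c, c i = false → h c = g₀ c) :
    bernExp α h = α * bernExp α g₁ + (1 - α) * bernExp α g₀ := by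
  have key : ∀ k : (ι → Bool) → ℝ, bernExp α k =
      ∑ d : {j // j ≠ i} → Bool, (∏ j, if d j then α else 1 - α) *
        (α * k ((Equiv.funSplitAt i Bool).symm (true, d)) +
          (1 - α) * k ((Equiv.funSplitAt i Bool).symm (false, d))) := by
    intro k
    rw [bernExp, ← Equiv.sum_comp (Equiv.funSplitAt i Bool).symm, Fintype.sum_prod_type_right]
    refine Finset.sum_congr rfl fun d _ => ?_
    have hp : ∀ b : Bool, (∏ j, if (Equiv.funSplitAt i Bool).symm (b, d) j then α else 1 - α) =
        (if b then α else 1 - α) * ∏ j, if d j then α else 1 - α := by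
      intro b
      rw [Fintype.prod_eq_mul_prod_subtype_ne _ i]
      congr 1
      · simp
      · refine Finset.prod_congr rfl fun j _ => ?_
        simp [j.2]
    rw [Fintype.sum_bool, hp, hp]
    simp
    ring
  have upd : ∀ (b b' : Bool) (d : {j // j ≠ i} → Bool),
      (Equiv.funSplitAt i Bool).symm (b, d) =
        Function.update ((Equiv.funSplitAt i Bool).symm (b', d)) i b := by
    intro b b' d
    funext j
    by_cases hj : j = i
    · subst hj; simp
    · simp [hj]
  rw [key h, key g₁, key g₀, Finset.mul_sum, Finset.mul_sum, ← Finset.sum_add_distrib]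
  refine Finset.sum_congr rfl fun d _ => ?_
  rw [h₁ _ (by simp), h₀ _ (by simp), upd false true d, hg₁, hg₀]
  rw [← hg₀ _ false, ← upd false true d]
  ring

end BernoulliProduct

section WiredClusters

variable {V E : Type*} [DecidableEq E] {ends : E → Sym2 V} {η : Finset E}

/-- The open subgraph of a finite set of edges. -/
def edgeGraph (ends : E → Sym2 V) (η : Finset E) : SimpleGraph V :=
  openSub ends (fun f => decide (f ∈ η))

theorem edgeGraph_adj {a b : V} :
    (edgeGraph ends η).Adj a b ↔ (∃ f ∈ η, ends f = s(a, b)) ∧ a ≠ b := by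
  simp [edgeGraph, openSub]

theorem edgeGraph_mono {ξ : Finset E} (h : η ⊆ ξ) : edgeGraph ends η ≤ edgeGraph ends ξ := by
  intro a b hab
  rw [edgeGraph_adj] at hab ⊢
  obtain ⟨⟨f, hf, hfe⟩, hne⟩ := hab
  exact ⟨⟨f, h hf, hfe⟩, hne⟩

variable [Fintype V] [DecidableEq V] {W : Finset V}

noncomputable def cluster (ends : E → Sym2 V) (η : Finset E) (u : V) : Finset V :=
  Finset.univ.filter (fun x => (edgeGraph ends η).Reachable u x)

/-- The vertices connected to the wired set `W`. -/
noncomputable def wiredSet (ends : E → Sym2 V) (η : Finset E) (W : Finset V) : Finset V :=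
  Finset.univ.filter (fun u => ∃ w ∈ W, (edgeGraph ends η).Reachable w u)

/-- The clusters that do not meet the wired set. -/
noncomputable def freeClusters (ends : E → Sym2 V) (η : Finset E) (W : Finset V) :
    Finset (Finset V) :=
  (Finset.univ \ wiredSet ends η W).image (cluster ends η)

/-- Spins read off from cluster colors, with the top value for vertices connected to the
wired set. -/
noncomputable def wiredSpin (ends : E → Sym2 V) (η : Finset E) (W : Finset V)
    (c : Finset V → Bool) : V → WithTop Bool :=
  fun u => if u ∈ wiredSet ends η W then ⊤ else (c (cluster ends η u) : WithTop Bool)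

theorem mem_wiredSet {u : V} :
    u ∈ wiredSet ends η W ↔ ∃ w ∈ W, (edgeGraph ends η).Reachable w u := by
  simp [wiredSet]

theorem cluster_eq_iff {u v : V} :
    cluster ends η u = cluster ends η v ↔ (edgeGraph ends η).Reachable u v := by
  constructor
  · intro h
    have : v ∈ cluster ends η u := by rw [h]; simp [cluster]
    simpa [cluster] using this
  · intro h
    ext x
    simp only [cluster, Finset.mem_filter, Finset.mem_univ, true_and]
    exact ⟨fun hx => h.symm.trans hx, fun hx => h.trans hx⟩

theorem wiredSet_of_reachable {u v : V} (hu : u ∈ wiredSet ends η W)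
    (h : (edgeGraph ends η).Reachable u v) : v ∈ wiredSet ends η W := by
  rw [mem_wiredSet] at hu ⊢
  obtain ⟨w, hw, hwu⟩ := hu
  exact ⟨w, hw, hwu.trans h⟩

theorem subset_wiredSet : W ⊆ wiredSet ends η W :=
  fun u hu => mem_wiredSet.2 ⟨u, hu, SimpleGraph.Reachable.refl _⟩

theorem mem_wiredSet_insert {u v : V} :
    u ∈ wiredSet ends η (insert v W) ↔
      (edgeGraph ends η).Reachable v u ∨ u ∈ wiredSet ends η W := by
  simp [mem_wiredSet]

theorem reachable_insert_edge {e : E} {w v : V} (he : ends e = s(w, v)) (hw : w ∈ W) {a b : V}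
    (h : (edgeGraph ends (insert e η)).Reachable a b) :
    (edgeGraph ends η).Reachable a b ∨
      (a ∈ wiredSet ends η (insert v W) ∧ b ∈ wiredSet ends η (insert v W)) := by
  rw [SimpleGraph.reachable_iff_reflTransGen] at h
  induction h with
  | refl => exact Or.inl (SimpleGraph.Reachable.refl _)
  | @tail b d hab hbd ih =>
    rw [edgeGraph_adj] at hbd
    obtain ⟨⟨f, hf, hfe⟩, hne⟩ := hbd
    rcases Finset.mem_insert.1 hf with rfl | hf
    · have hbd' : b ∈ wiredSet ends η (insert v W) ∧ d ∈ wiredSet ends η (insert v W) := by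
        have hwm : w ∈ wiredSet ends η (insert v W) :=
          subset_wiredSet (Finset.mem_insert_of_mem hw)
        have hvm : v ∈ wiredSet ends η (insert v W) :=
          subset_wiredSet (Finset.mem_insert_self _ _)
        rw [he] at hfe
        rcases Sym2.eq_iff.1 hfe with ⟨rfl, rfl⟩ | ⟨rfl, rfl⟩
        · exact ⟨hwm, hvm⟩
        · exact ⟨hvm, hwm⟩
      rcases ih with ih | ih
      · exact Or.inr ⟨wiredSet_of_reachable hbd'.1 ih.symm, hbd'.2⟩
      · exact Or.inr ⟨ih.1, hbd'.2⟩
    · have hadj : (edgeGraph ends η).Reachable b d :=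
        (edgeGraph_adj.2 ⟨⟨f, hf, hfe⟩, hne⟩ : (edgeGraph ends η).Adj b d).reachable
      rcases ih with ih | ih
      · exact Or.inl (ih.trans hadj)
      · exact Or.inr ⟨ih.1, wiredSet_of_reachable ih.2 hadj⟩

theorem wiredSet_insert_edge {e : E} {w v : V} (he : ends e = s(w, v)) (hw : w ∈ W) :
    wiredSet ends (insert e η) W = wiredSet ends η (insert v W) := by
  have hle : edgeGraph ends η ≤ edgeGraph ends (insert e η) :=
    edgeGraph_mono (Finset.subset_insert _ _)
  ext u
  constructor
  · intro hu
    obtain ⟨w', hw', h⟩ := mem_wiredSet.1 hu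
    rcases reachable_insert_edge he hw h with h | h
    · exact mem_wiredSet.2 ⟨w', Finset.mem_insert_of_mem hw', h⟩
    · exact h.2
  · intro hu
    rcases mem_wiredSet_insert.1 hu with h | h
    · refine mem_wiredSet.2 ⟨w, hw, ?_⟩
      refine SimpleGraph.Reachable.trans ?_ (h.mono hle)
      by_cases hwv : w = v
      · rw [hwv]
      · exact (edgeGraph_adj.2 ⟨⟨e, Finset.mem_insert_self _ _, he⟩, hwv⟩ :
          (edgeGraph ends (insert e η)).Adj w v).reachable
    · obtain ⟨w', hw', h⟩ := mem_wiredSet.1 h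
      exact mem_wiredSet.2 ⟨w', hw', h.mono hle⟩

theorem cluster_insert_edge {e : E} {w v : V} (he : ends e = s(w, v)) (hw : w ∈ W) {u : V}
    (hu : u ∉ wiredSet ends η (insert v W)) :
    cluster ends (insert e η) u = cluster ends η u := by
  ext x
  simp only [cluster, Finset.mem_filter, Finset.mem_univ, true_and]
  refine ⟨fun h => ?_, fun h => h.mono (edgeGraph_mono (Finset.subset_insert _ _))⟩
  rcases reachable_insert_edge he hw h with h | h
  · exact h
  · exact absurd h.1 hu

theorem freeClusters_insert_edge {e : E} {w v : V} (he : ends e = s(w, v)) (hw : w ∈ W) :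
    freeClusters ends (insert e η) W = freeClusters ends η (insert v W) := by
  rw [freeClusters, freeClusters, wiredSet_insert_edge he hw]
  refine Finset.image_congr fun u hu => cluster_insert_edge he hw ?_
  simpa using hu

theorem wiredSpin_insert_edge {e : E} {w v : V} (he : ends e = s(w, v)) (hw : w ∈ W)
    (c : Finset V → Bool) :
    wiredSpin ends (insert e η) W c = wiredSpin ends η (insert v W) c := by
  funext u
  simp only [wiredSpin, wiredSet_insert_edge he hw]
  split_ifs with h
  · rfl
  · rw [cluster_insert_edge he hw h]

theorem wiredSet_insert_of_mem {v : V} (hv : v ∈ wiredSet ends η W) :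
    wiredSet ends η (insert v W) = wiredSet ends η W := by
  ext u
  rw [mem_wiredSet_insert]
  exact ⟨fun h => h.elim (wiredSet_of_reachable hv) id, Or.inr⟩

theorem freeClusters_insert_of_mem {v : V} (hv : v ∈ wiredSet ends η W) :
    freeClusters ends η (insert v W) = freeClusters ends η W := by
  rw [freeClusters, freeClusters, wiredSet_insert_of_mem hv]

theorem wiredSpin_insert_of_mem {v : V} (hv : v ∈ wiredSet ends η W) (c : Finset V → Bool) :
    wiredSpin ends η (insert v W) c = wiredSpin ends η W c := by
  funext u
  simp only [wiredSpin, wiredSet_insert_of_mem hv]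

theorem card_freeClusters_of_notMem {v : V} (hv : v ∉ wiredSet ends η W) :
    (freeClusters ends η W).card = (freeClusters ends η (insert v W)).card + 1 := by
  have hins : freeClusters ends η W =
      insert (cluster ends η v) (freeClusters ends η (insert v W)) := by
    ext C
    simp only [freeClusters, Finset.mem_image, Finset.mem_insert, Finset.mem_sdiff,
      Finset.mem_univ, true_and, mem_wiredSet_insert, not_or]
    constructor
    · rintro ⟨u, hu, rfl⟩
      by_cases h : (edgeGraph ends η).Reachable v u
      · exact Or.inl (cluster_eq_iff.2 h.symm)
      · exact Or.inr ⟨u, ⟨h, hu⟩, rfl⟩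
    · rintro (rfl | ⟨u, hu, rfl⟩)
      · exact ⟨v, hv, rfl⟩
      · exact ⟨u, hu.2, rfl⟩
  rw [hins, Finset.card_insert_of_notMem]
  simp only [freeClusters, Finset.mem_image, Finset.mem_sdiff,
      Finset.mem_univ, true_and, mem_wiredSet_insert, not_or]
  rintro ⟨u, hu, h⟩
  exact hu.1 (cluster_eq_iff.1 h).symm

theorem wiredSpin_le_insert (v : V) (c : Finset V → Bool) :
    wiredSpin ends η W c ≤ wiredSpin ends η (insert v W) c := by
  intro u
  simp only [wiredSpin, mem_wiredSet_insert]
  by_cases h : u ∈ wiredSet ends η W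
  · simp [h]
  · by_cases h' : (edgeGraph ends η).Reachable v u <;> simp [h, h']

theorem wiredSet_eq_self (h : ∀ e ∈ η, ∀ w ∈ W, ∀ v ∉ W, ends e ≠ s(w, v)) :
    wiredSet ends η W = W := by
  refine Finset.Subset.antisymm (fun u hu => ?_) subset_wiredSet
  obtain ⟨w, hw, hr⟩ := mem_wiredSet.1 hu
  rw [SimpleGraph.reachable_iff_reflTransGen] at hr
  induction hr with
  | refl => exact hw
  | @tail b d hab hbd ih =>
    obtain ⟨⟨f, hf, hfe⟩, -⟩ := edgeGraph_adj.1 hbd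
    by_contra hd
    exact h f hf b (ih (mem_wiredSet.2 ⟨w, hw,
      (SimpleGraph.reachable_iff_reflTransGen _ _).2 hab⟩)) d hd hfe

end WiredClusters

section Recolor

variable {V : Type*} [DecidableEq V]

/-- Give the spin `b` to every top-valued vertex outside `W`, and the top value on `W`. -/
def recolor (W : Finset V) (b : Bool) (ω : V → WithTop Bool) : V → WithTop Bool :=
  fun u => if u ∈ W then ⊤ else if ω u = ⊤ then (b : WithTop Bool) else ω u

theorem recolor_true_mono (W : Finset V) : Monotone (recolor W true) := by
  intro ω ω' h u
  have hu := h u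
  simp only [recolor]
  revert hu
  generalize ω u = a
  generalize ω' u = b
  split_ifs with h1 h2 h3 h4
  · simp
  · simp
  · intro h; exact absurd (top_le_iff.1 (h2 ▸ h)) h3
  · intro _
    induction a using WithTop.recTopCoe with
    | top => exact absurd rfl h2
    | coe a => exact WithTop.coe_le_coe.2 (Bool.le_true a)
  · exact id

theorem recolor_false_not_anti (W : Finset V) :
    Antitone (fun ω : V → WithTop Bool =>
      recolor W false (fun u => WithTop.map (fun b => !b) (ω u))) := by
  intro ω ω' h u
  have hu := h u
  simp only [recolor]
  revert hu
  generalize ω u = a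
  generalize ω' u = b
  by_cases hW : u ∈ W
  · simp [hW]
  · induction a using WithTop.recTopCoe with
    | top =>
      intro h
      rw [top_le_iff.1 h]
    | coe a =>
      induction b using WithTop.recTopCoe with
      | top => intro _; cases a <;> simp [hW]
      | coe b => cases a <;> cases b <;> simp [hW]

end Recolor

section PositiveAssociation

variable {V E : Type*} [Fintype V] [DecidableEq V] [DecidableEq E]

/-- Unnormalized expectation of `f` under the random cluster measure on the edges `F` with wired
set `W`, whose free clusters are colored independently. -/
noncomputable def wiredSum (ends : E → Sym2 V) (y : E → ℝ) (q α : ℝ) (F : Finset E)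
    (W : Finset V) (f : (V → WithTop Bool) → ℝ) : ℝ :=
  ∑ η ∈ F.powerset, (∏ e ∈ η, y e) * q ^ (freeClusters ends η W).card *
    bernExp α (fun c => f (wiredSpin ends η W c))

variable {ends : E → Sym2 V} {y : E → ℝ} {q α : ℝ} {F : Finset E} {W : Finset V}

theorem wiredSum_mono (hy : ∀ e, 0 < y e) (hq : 1 ≤ q) (h0 : 0 ≤ α) (h1 : α ≤ 1)
    {f g : (V → WithTop Bool) → ℝ} (hfg : ∀ ω, f ω ≤ g ω) :
    wiredSum ends y q α F W f ≤ wiredSum ends y q α F W g := by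
  refine Finset.sum_le_sum fun η _ => mul_le_mul_of_nonneg_left
    (bernExp_mono h0 h1 fun c => hfg _) ?_
  have := Finset.prod_nonneg (s := η) fun e _ => (hy e).le
  positivity

theorem wiredSum_const (a : ℝ) :
    wiredSum ends y q α F W (fun _ => a) = wiredSum ends y q α F W (fun _ => 1) * a := by
  simp only [wiredSum, bernExp_const, Finset.sum_mul, mul_one]

theorem wiredSum_one_pos (hy : ∀ e, 0 < y e) (hq : 1 ≤ q) :
    0 < wiredSum ends y q α F W (fun _ => 1) := by
  refine Finset.sum_pos (fun η _ => ?_) ⟨∅, by simp⟩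
  have := Finset.prod_pos (s := η) fun e _ => hy e
  rw [bernExp_const]
  positivity

theorem wiredSum_neg (f : (V → WithTop Bool) → ℝ) :
    wiredSum ends y q α F W (fun ω => -f ω) = -wiredSum ends y q α F W f := by
  simp [wiredSum, bernExp]

theorem wiredSum_map_not (f : (V → WithTop Bool) → ℝ) :
    wiredSum ends y q α F W f =
      wiredSum ends y q (1 - α) F W (fun ω => f (fun u => WithTop.map (fun b => !b) (ω u))) := by
  refine Finset.sum_congr rfl fun η _ => ?_
  rw [bernExp_not]
  congr 2
  funext c
  congr 1
  funext u
  simp only [wiredSpin]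
  split_ifs <;> simp

theorem wiredSum_insert_edge {e : E} {w v : V} (he : ends e = s(w, v)) (hw : w ∈ W)
    (heF : e ∉ F) (f : (V → WithTop Bool) → ℝ) :
    wiredSum ends y q α (insert e F) W f =
      wiredSum ends y q α F W f + y e * wiredSum ends y q α F (insert v W) f := by
  rw [wiredSum, Finset.sum_powerset_insert heF]
  congr 1
  rw [wiredSum, Finset.mul_sum]
  refine Finset.sum_congr rfl fun η hη => ?_
  have : e ∉ η := fun h => heF (Finset.mem_powerset.1 hη h)
  rw [Finset.prod_insert this, freeClusters_insert_edge he hw]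
  simp only [wiredSpin_insert_edge he hw]
  ring

/-- Positive association of the wired measure, in unnormalized form. -/
def WiredPA (ends : E → Sym2 V) (y : E → ℝ) (q α : ℝ) (F : Finset E) (W : Finset V) : Prop :=
  ∀ f g : (V → WithTop Bool) → ℝ, Monotone f → Monotone g →
    wiredSum ends y q α F W f * wiredSum ends y q α F W g ≤
      wiredSum ends y q α F W (fun _ => 1) * wiredSum ends y q α F W (fun ω => f ω * g ω)

theorem WiredPA.antitone (h : WiredPA ends y q α F W) {f g : (V → WithTop Bool) → ℝ}
    (hf : Antitone f) (hg : Antitone g) :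
    wiredSum ends y q α F W f * wiredSum ends y q α F W g ≤
      wiredSum ends y q α F W (fun _ => 1) * wiredSum ends y q α F W (fun ω => f ω * g ω) := by
  have := h (fun ω => -f ω) (fun ω => -g ω) (fun a b hab => neg_le_neg (hf hab))
    (fun a b hab => neg_le_neg (hg hab))
  simpa [wiredSum_neg] using this

/-- Wiring one more vertex increases the measure stochastically. -/
theorem WiredPA.wiredSum_insert_vertex (h : WiredPA ends y q α F W) (hy : ∀ e, 0 < y e)
    (hq : 1 ≤ q) (h0 : 0 ≤ α) (h1 : α ≤ 1) (v : V) {f : (V → WithTop Bool) → ℝ}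
    (hf : Monotone f) :
    wiredSum ends y q α F W f * wiredSum ends y q α F (insert v W) (fun _ => 1) ≤
      wiredSum ends y q α F (insert v W) f * wiredSum ends y q α F W (fun _ => 1) := by
  let a (g : (V → WithTop Bool) → ℝ) : ℝ := ∑ η ∈ F.powerset,
    if v ∈ wiredSet ends η W then (∏ e ∈ η, y e) * q ^ (freeClusters ends η W).card *
      bernExp α (fun c => g (wiredSpin ends η W c)) else 0
  let d (g : (V → WithTop Bool) → ℝ) : ℝ := ∑ η ∈ F.powerset,
    if v ∈ wiredSet ends η W then 0 else
      (∏ e ∈ η, y e) * q ^ (freeClusters ends η (insert v W)).card *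
        bernExp α (fun c => g (wiredSpin ends η W c))
  have hpos : ∀ η : Finset E, 0 ≤ ∏ e ∈ η, y e := fun η =>
    Finset.prod_nonneg fun e _ => (hy e).le
  have hW : ∀ g, wiredSum ends y q α F W g = a g + q * d g := by
    intro g
    simp only [a, d, Finset.mul_sum, ← Finset.sum_add_distrib]
    refine Finset.sum_congr rfl fun η _ => ?_
    split_ifs with hv
    · simp
    · rw [card_freeClusters_of_notMem hv]; ring
  have hle : a f + d f ≤ wiredSum ends y q α F (insert v W) f := by
    simp only [a, d, ← Finset.sum_add_distrib]
    refine Finset.sum_le_sum fun η _ => ?_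
    split_ifs with hv
    · simp [freeClusters_insert_of_mem hv, wiredSpin_insert_of_mem hv]
    · rw [zero_add]
      have := hpos η
      exact mul_le_mul_of_nonneg_left
        (bernExp_mono h0 h1 fun c => hf (wiredSpin_le_insert v c)) (by positivity)
  have hone : wiredSum ends y q α F (insert v W) (fun _ => 1) =
      a (fun _ => 1) + d (fun _ => 1) := by
    simp only [a, d, ← Finset.sum_add_distrib]
    refine Finset.sum_congr rfl fun η _ => ?_
    split_ifs with hv
    · simp [freeClusters_insert_of_mem hv]
    · simp [bernExp_const]
  have hind : ∀ g : (V → WithTop Bool) → ℝ,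
      wiredSum ends y q α F W (fun ω => (if ω v = ⊤ then 1 else 0) * g ω) = a g := by
    intro g
    refine Finset.sum_congr rfl fun η _ => ?_
    split_ifs with hv
    · simp [wiredSpin, hv]
    · simp [wiredSpin, hv, bernExp_const]
  have hmono : Monotone (fun ω : V → WithTop Bool => if ω v = ⊤ then (1 : ℝ) else 0) := by
    intro ω ω' hω
    have := hω v
    by_cases h1 : ω v = ⊤
    · have h2 : ω' v = ⊤ := top_le_iff.1 (h1 ▸ this)
      simp [h1, h2]
    · simp only [h1, if_false]
      split_ifs <;> norm_num
  have hcov := h _ f hmono hf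
  have hind1 := hind (fun _ => 1)
  simp only [mul_one] at hind1
  rw [hind, hind1, hW, hW] at hcov
  have hS := wiredSum_one_pos (ends := ends) (α := α) (F := F) (W := W) hy hq
  have hfac := mul_le_mul_of_nonneg_right hle hS.le
  refine le_trans ?_ hfac
  rw [hone, hW, hW]
  have hq0 : 0 < q := by linarith
  have hcov' : a (fun _ => 1) * d f ≤ a f * d (fun _ => 1) := by
    have : q * (a (fun _ => 1) * d f) ≤ q * (a f * d (fun _ => 1)) := by linarith
    exact le_of_mul_le_mul_left this hq0
  nlinarith [mul_le_mul_of_nonneg_left hcov' (sub_nonneg.2 hq)]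

/-- Positive association of a mixture of two positively associated measures that are
stochastically ordered, in unnormalized form. -/
theorem mixture_pos_assoc {a₀ a₁ b₀ b₁ c₀ c₁ n₀ n₁ : ℝ} (hn₀ : 0 < n₀) (hn₁ : 0 < n₁)
    (h₀ : a₀ * b₀ ≤ n₀ * c₀) (h₁ : a₁ * b₁ ≤ n₁ * c₁) (ha : a₀ * n₁ ≤ a₁ * n₀)
    (hb : b₀ * n₁ ≤ b₁ * n₀) :
    (a₀ + a₁) * (b₀ + b₁) ≤ (n₀ + n₁) * (c₀ + c₁) := by
  have h := mul_nonneg (sub_nonneg.2 ha) (sub_nonneg.2 hb)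
  have hn := mul_pos hn₀ hn₁
  have e₀ := mul_le_mul_of_nonneg_left h₀ (by positivity : 0 ≤ n₁ * (n₀ + n₁))
  have e₁ := mul_le_mul_of_nonneg_left h₁ (by positivity : 0 ≤ n₀ * (n₀ + n₁))
  refine le_of_mul_le_mul_left ?_ hn
  nlinarith

/-- Case of the induction where an edge of `F` joins `W` to its complement. -/
theorem WiredPA.insert_edge {e : E} {w v : V} (he : ends e = s(w, v)) (hw : w ∈ W)
    (heF : e ∉ F) (hy : ∀ e, 0 < y e) (hq : 1 ≤ q) (h0 : 0 ≤ α) (h1 : α ≤ 1)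
    (hW : WiredPA ends y q α F W) (hvW : WiredPA ends y q α F (insert v W)) :
    WiredPA ends y q α (insert e F) W := by
  intro f g hf hg
  simp only [wiredSum_insert_edge he hw heF]
  have hye := hy e
  have hp := wiredSum_one_pos (ends := ends) (α := α) (F := F) (W := W) hy hq
  have hp' := wiredSum_one_pos (ends := ends) (α := α) (F := F) (W := insert v W) hy hq
  refine mixture_pos_assoc hp (mul_pos hye hp') (hW f g hf hg) ?_ ?_ ?_
  · have := mul_le_mul_of_nonneg_left (hvW f g hf hg) (by positivity : 0 ≤ y e * y e)
    linarith
  · have := mul_le_mul_of_nonneg_left (hW.wiredSum_insert_vertex hy hq h0 h1 v hf) hye.le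
    linarith
  · have := mul_le_mul_of_nonneg_left (hW.wiredSum_insert_vertex hy hq h0 h1 v hg) hye.le
    linarith

theorem wiredSum_isolated {v : V} (hv : v ∉ W)
    (h : ∀ e ∈ F, ∀ w ∈ W, ∀ v ∉ W, ends e ≠ s(w, v)) (f : (V → WithTop Bool) → ℝ) :
    wiredSum ends y q α F W f =
      q * (α * wiredSum ends y q α F (insert v W) (fun ω => f (recolor W true ω)) +
        (1 - α) * wiredSum ends y q α F (insert v W) (fun ω => f (recolor W false ω))) := by
  simp only [wiredSum, Finset.mul_sum, ← Finset.sum_add_distrib]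
  refine Finset.sum_congr rfl fun η hη => ?_
  have hself : wiredSet ends η W = W :=
    wiredSet_eq_self fun e he => h e (Finset.mem_powerset.1 hη he)
  have hrec : ∀ c : Finset V → Bool, wiredSpin ends η W c =
      recolor W (c (cluster ends η v)) (wiredSpin ends η (insert v W) c) := by
    intro c
    funext u
    simp only [wiredSpin, recolor, mem_wiredSet_insert, hself]
    by_cases hu : u ∈ W
    · simp [hu]
    · by_cases hr : (edgeGraph ends η).Reachable v u
      · simp [hu, hr, cluster_eq_iff.2 hr]
      · simp [hu, hr]
  have hupd : ∀ (c : Finset V → Bool) (b : Bool),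
      wiredSpin ends η (insert v W) (Function.update c (cluster ends η v) b) =
        wiredSpin ends η (insert v W) c := by
    intro c b
    funext u
    simp only [wiredSpin, mem_wiredSet_insert]
    by_cases hr : (edgeGraph ends η).Reachable v u
    · simp [hr]
    · rw [Function.update_of_ne]
      intro hc
      exact hr (cluster_eq_iff.1 hc).symm
  rw [bernExp_split (cluster ends η v) _
    (fun c => f (recolor W true (wiredSpin ends η (insert v W) c)))
    (fun c => f (recolor W false (wiredSpin ends η (insert v W) c)))
    (fun c b => by rw [hupd]) (fun c b => by rw [hupd])
    (fun c hc => by rw [hrec, hc]) (fun c hc => by rw [hrec, hc]),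
    card_freeClusters_of_notMem (hself.symm ▸ hv)]
  ring

/-- Case of the induction where no edge of `F` joins `W` to its complement. -/
theorem WiredPA.of_isolated {v : V} (hv : v ∉ W)
    (h : ∀ e ∈ F, ∀ w ∈ W, ∀ v ∉ W, ends e ≠ s(w, v)) (hy : ∀ e, 0 < y e) (hq : 1 ≤ q)
    (h0 : 0 < α) (h1 : α < 1) (hα : WiredPA ends y q α F (insert v W))
    (hα' : WiredPA ends y q (1 - α) F (insert v W)) :
    WiredPA ends y q α F W := by
  intro f g hf hg
  simp only [wiredSum_isolated hv h]
  have hp := wiredSum_one_pos (ends := ends) (α := α) (F := F) (W := insert v W) hy hq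
  have hβ : 0 < 1 - α := by linarith
  have hT := hα _ _ (hf.comp (recolor_true_mono W)) (hg.comp (recolor_true_mono W))
  have hF := hα'.antitone (hf.comp_antitone (recolor_false_not_anti W))
    (hg.comp_antitone (recolor_false_not_anti W))
  have hsw := fun k => wiredSum_map_not (ends := ends) (y := y) (q := q) (α := α) (F := F)
    (W := insert v W) k
  have hF' : wiredSum ends y q α F (insert v W) (fun ω => f (recolor W false ω)) *
      wiredSum ends y q α F (insert v W) (fun ω => g (recolor W false ω)) ≤
      wiredSum ends y q α F (insert v W) (fun _ => 1) *
        wiredSum ends y q α F (insert v W)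
          (fun ω => f (recolor W false ω) * g (recolor W false ω)) := by
    rw [hsw (fun ω => f (recolor W false ω)), hsw (fun ω => g (recolor W false ω)),
      hsw (fun _ => 1), hsw (fun ω => f (recolor W false ω) * g (recolor W false ω))]
    exact hF
  have hle : ∀ ω, recolor W false ω ≤ recolor W true ω := by
    intro ω u
    simp only [recolor]
    split_ifs
    · exact le_rfl
    · exact WithTop.coe_le_coe.2 (Bool.false_le true)
    · exact le_rfl
  have hmf := wiredSum_mono (ends := ends) (F := F) (W := insert v W) hy hq h0.le h1.le
    fun ω => hf (hle ω)
  have hmg := wiredSum_mono (ends := ends) (F := F) (W := insert v W) hy hq h0.le h1.le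
    fun ω => hg (hle ω)
  simp only [Function.comp_def] at hT
  generalize wiredSum ends y q α F (insert v W) (fun _ => 1) = n at *
  generalize wiredSum ends y q α F (insert v W) (fun ω => f (recolor W true ω)) = a₁ at *
  generalize wiredSum ends y q α F (insert v W) (fun ω => f (recolor W false ω)) = a₀ at *
  generalize wiredSum ends y q α F (insert v W) (fun ω => g (recolor W true ω)) = b₁ at *
  generalize wiredSum ends y q α F (insert v W) (fun ω => g (recolor W false ω)) = b₀ at *
  generalize wiredSum ends y q α F (insert v W)
    (fun ω => f (recolor W true ω) * g (recolor W true ω)) = c₁ at *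
  generalize wiredSum ends y q α F (insert v W)
    (fun ω => f (recolor W false ω) * g (recolor W false ω)) = c₀ at *
  have key : ((1 - α) * a₀ + α * a₁) * ((1 - α) * b₀ + α * b₁) ≤
      ((1 - α) * n + α * n) * ((1 - α) * c₀ + α * c₁) :=
    mixture_pos_assoc (mul_pos hβ hp) (mul_pos h0 hp)
      (by linarith [mul_le_mul_of_nonneg_left hF' (mul_pos hβ hβ).le])
      (by linarith [mul_le_mul_of_nonneg_left hT (mul_pos h0 h0).le])
      (by linarith [mul_le_mul_of_nonneg_left hmf (mul_pos (mul_pos h0 hβ) hp).le])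
      (by linarith [mul_le_mul_of_nonneg_left hmg (mul_pos (mul_pos h0 hβ) hp).le])
  have := mul_le_mul_of_nonneg_left key (mul_self_nonneg q)
  linarith

theorem WiredPA.of_univ : WiredPA ends y q α F (Finset.univ : Finset V) := by
  have hspin : ∀ (η : Finset E) c, wiredSpin ends η Finset.univ c = fun _ => ⊤ := by
    intro η c
    funext u
    simp [wiredSpin, subset_wiredSet (Finset.mem_univ u)]
  have hconst : ∀ f : (V → WithTop Bool) → ℝ, wiredSum ends y q α F Finset.univ f =
      wiredSum ends y q α F Finset.univ (fun _ => 1) * f (fun _ => ⊤) := by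
    intro f
    rw [← wiredSum_const]
    simp only [wiredSum, hspin]
  intro f g _ _
  rw [hconst f, hconst g, hconst (fun ω => f ω * g ω)]
  exact le_of_eq (by ring)

theorem wiredPA (hy : ∀ e, 0 < y e) (hq : 1 ≤ q) :
    ∀ (n : ℕ) (F : Finset E) (W : Finset V) (α : ℝ), F.card + Wᶜ.card = n → 0 < α → α < 1 →
      WiredPA ends y q α F W := by
  intro n
  induction n using Nat.strong_induction_on with
  | _ n ih =>
  intro F W α hn h0 h1
  have hdrop : ∀ v ∉ W, (insert v W)ᶜ.card < Wᶜ.card := by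
    intro v hv
    refine Finset.card_lt_card (Finset.compl_ssubset_compl.2 (Finset.ssubset_insert hv))
  by_cases h : ∀ e ∈ F, ∀ w ∈ W, ∀ v ∉ W, ends e ≠ s(w, v)
  · by_cases hW : W = Finset.univ
    · rw [hW]
      exact WiredPA.of_univ
    · obtain ⟨v, hv⟩ : ∃ v, v ∉ W := by
        by_contra! hall
        exact hW (Finset.eq_univ_iff_forall.2 hall)
      have := hdrop v hv
      exact WiredPA.of_isolated hv h hy hq h0 h1
        (ih _ (by omega) F (insert v W) α rfl h0 h1)
        (ih _ (by omega) F (insert v W) (1 - α) rfl (by linarith) (by linarith))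
  · push Not at h
    obtain ⟨e, heF, w, hw, v, hv, he⟩ := h
    have := hdrop v hv
    have hc := Finset.card_erase_add_one heF
    rw [← Finset.insert_erase heF]
    exact WiredPA.insert_edge he hw (Finset.notMem_erase e F) hy hq h0.le h1.le
      (ih _ (by omega) (F.erase e) W α rfl h0 h1)
      (ih _ (by omega) (F.erase e) (insert v W) α rfl h0 h1)

end PositiveAssociation

/-- The monotone projection to genuine spins, sending the top value to `true`. -/
def toSpin {V : Type*} (ω : V → WithTop Bool) : V → Bool :=
  fun u => decide (((true : Bool) : WithTop Bool) ≤ ω u)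

theorem toSpin_mono {V : Type*} : Monotone (toSpin : (V → WithTop Bool) → V → Bool) := by
  intro ω ω' h u
  simp only [toSpin]
  by_cases hu : ((true : Bool) : WithTop Bool) ≤ ω u
  · simp [hu, hu.trans (h u)]
  · simp [hu]

section FuzzyPotts

variable {V E : Type*} [Fintype V] [DecidableEq V] [DecidableEq E]

theorem card_components_subtype (ends : E → Sym2 V) (η : Finset E) (P : V → Prop) :
    Nat.card {K : (edgeGraph ends η).ConnectedComponent //
      ∃ v, (edgeGraph ends η).connectedComponentMk v = K ∧ P v} =
      ((Finset.univ.filter P).image (cluster ends η)).card := by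
  let g : (edgeGraph ends η).ConnectedComponent → Finset V :=
    Quot.lift (cluster ends η) fun _ _ h => cluster_eq_iff.2 h
  have hg : Function.Injective g := by
    intro K L
    induction K using SimpleGraph.ConnectedComponent.ind
    induction L using SimpleGraph.ConnectedComponent.ind
    intro h
    exact SimpleGraph.ConnectedComponent.sound (cluster_eq_iff.1 h)
  have himg : (Finset.univ.filter P).image (cluster ends η) =
      ((Finset.univ.filter P).image (edgeGraph ends η).connectedComponentMk).image g := by
    rw [Finset.image_image]
    rfl
  rw [himg, Finset.card_image_of_injective _ hg]
  refine Nat.subtype_card _ fun K => ?_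
  simp [and_comm]

theorem numComp_eq (ends : E → Sym2 V) (η : Finset E) :
    numComp ends (fun f => decide (f ∈ η)) = (freeClusters ends η ∅).card := by
  have h := card_components_subtype ends η (fun _ => True)
  have hW : wiredSet ends η ∅ = ∅ := by simp [wiredSet]
  rw [freeClusters, hW, Finset.sdiff_empty, ← Finset.filter_true (s := Finset.univ) (h := _), ← h]
  refine (Nat.card_congr (Equiv.subtypeUnivEquiv fun K => ?_)).symm
  induction K using SimpleGraph.ConnectedComponent.ind with
  | _ v => exact ⟨v, rfl, trivial⟩

theorem colorWeight_eq (ends : E → Sym2 V) (α : ℝ) (η : Finset E) (σ : V → Bool) :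
    colorWeight ends α (fun f => decide (f ∈ η)) σ =
      bernExp α (fun c : Finset V → Bool =>
        if (fun u => c (cluster ends η u)) = σ then 1 else 0) := by
  have hG : openSub ends (fun f => decide (f ∈ η)) = edgeGraph ends η := rfl
  rw [colorWeight, hG]
  rw [card_components_subtype, card_components_subtype]
  set T : Bool → Finset (Finset V) := fun b =>
    (Finset.univ.filter (fun v => σ v = b)).image (cluster ends η) with hT
  have hmem : ∀ b C, C ∈ T b ↔ ∃ v, σ v = b ∧ cluster ends η v = C := by
    intro b C
    simp [hT]
  split_ifs with hc
  · have hdisj : ∀ C, C ∈ T true → C ∉ T false := by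
      intro C h1 h2
      obtain ⟨u, hu, rfl⟩ := (hmem _ _).1 h1
      obtain ⟨v, hv, hvu⟩ := (hmem _ _).1 h2
      have := hc v u (cluster_eq_iff.1 hvu)
      rw [hu, hv] at this
      exact absurd this (by decide)
    let t : Finset V → Finset Bool := fun C =>
      if C ∈ T true then {true} else if C ∈ T false then {false} else Finset.univ
    have ht : ∀ c : Finset V → Bool,
        (fun u => c (cluster ends η u)) = σ ↔ c ∈ Fintype.piFinset t := by
      intro c
      rw [Fintype.mem_piFinset]
      constructor
      · rintro h C
        by_cases h1 : C ∈ T true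
        · obtain ⟨u, hu, rfl⟩ := (hmem _ _).1 h1
          have := congrFun h u
          simp [t, h1, this, hu]
        · by_cases h2 : C ∈ T false
          · obtain ⟨u, hu, rfl⟩ := (hmem _ _).1 h2
            have := congrFun h u
            simp [t, h1, h2, this, hu]
          · simp [t, h1, h2]
      · intro h
        funext u
        have hu := h (cluster ends η u)
        have hm : cluster ends η u ∈ T (σ u) := (hmem _ _).2 ⟨u, rfl, rfl⟩
        cases hσ : σ u with
        | true =>
          rw [hσ] at hm
          simpa [t, hm] using hu
        | false =>
          rw [hσ] at hm
          have hn : cluster ends η u ∉ T true := fun h' => hdisj _ h' hm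
          simpa [t, hm, hn] using hu
    simp only [bernExp, ht, mul_ite, mul_one, mul_zero]
    rw [← Finset.sum_filter, Finset.filter_mem_eq_inter, Finset.univ_inter,
      ← Finset.prod_univ_sum t (fun _ b => if b = true then α else 1 - α)]
    have hfac : ∀ C, (∑ b ∈ t C, if b = true then α else 1 - α) =
        (if C ∈ T true then α else 1) * (if C ∈ T false then 1 - α else 1) := by
      intro C
      by_cases h1 : C ∈ T true
      · simp [t, h1, hdisj C h1]
      · by_cases h2 : C ∈ T false <;> simp [t, h1, h2]
    simp only [hfac, Finset.prod_mul_distrib, Finset.prod_ite_mem_eq, Finset.prod_const]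
    simp only [hT]
    congr!
  · have : ∀ c : Finset V → Bool, (fun u => c (cluster ends η u)) ≠ σ := by
      rintro c rfl
      exact hc fun u v h => congrArg c (cluster_eq_iff.2 h)
    simp [this, bernExp_const]

theorem toSpin_wiredSpin_empty (ends : E → Sym2 V) (η : Finset E) (c : Finset V → Bool) :
    toSpin (wiredSpin ends η ∅ c) = fun u => c (cluster ends η u) := by
  funext u
  have hW : wiredSet ends η ∅ = ∅ := by simp [wiredSet]
  simp only [toSpin, wiredSpin, hW, Finset.notMem_empty, if_false, WithTop.coe_le_coe]
  cases c (cluster ends η u) <;> decide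

variable [Fintype E]

theorem rcWeight_eq (ends : E → Sym2 V) {p : E → ℝ} (hp : ∀ f, p f < 1) (q : ℝ)
    (η : Finset E) :
    rcWeight ends p q (fun f => decide (f ∈ η)) =
      (∏ f, (1 - p f)) *
        ((∏ f ∈ η, p f / (1 - p f)) * q ^ (freeClusters ends η ∅).card) := by
  rw [rcWeight, numComp_eq, ← mul_assoc]
  congr 1
  rw [← Finset.prod_ite_mem_eq (s := η), ← Finset.prod_mul_distrib]
  refine Finset.prod_congr rfl fun f _ => ?_
  have : 1 - p f ≠ 0 := (sub_pos.2 (hp f)).ne'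
  by_cases h : f ∈ η <;> simp [h]
  field_simp

theorem sum_bool_fun_eq_sum_powerset (k : (E → Bool) → ℝ) :
    ∑ η : E → Bool, k η =
      ∑ η ∈ (Finset.univ : Finset E).powerset, k (fun f => decide (f ∈ η)) := by
  rw [Finset.powerset_univ]
  refine Finset.sum_nbij' (fun η => Finset.univ.filter (fun f => η f = true))
    (fun η f => decide (f ∈ η)) ?_ ?_ ?_ ?_ ?_ <;> intros <;> simp

/-- Expectations under the fractional fuzzy Potts measure, as wired sums with no wired vertex. -/
theorem sum_ffpMeasure_mul (ends : E → Sym2 V) {p : E → ℝ} (hp : ∀ f, p f < 1) (q α : ℝ)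
    (f : (V → Bool) → ℝ) :
    ∑ σ, ffpMeasure ends p q α σ * f σ =
      wiredSum ends (fun e => p e / (1 - p e)) q α Finset.univ ∅ (fun ω => f (toSpin ω)) /
        wiredSum ends (fun e => p e / (1 - p e)) q α Finset.univ ∅ (fun _ => 1) := by
  have hP : (∏ f, (1 - p f)) ≠ 0 :=
    Finset.prod_ne_zero_iff.2 fun f _ => (sub_pos.2 (hp f)).ne'
  have hZ : ∑ τ, rcWeight ends p q τ = (∏ f, (1 - p f)) *
      wiredSum ends (fun e => p e / (1 - p e)) q α Finset.univ ∅ (fun _ => 1) := by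
    rw [sum_bool_fun_eq_sum_powerset, wiredSum, Finset.mul_sum]
    simp only [rcWeight_eq ends hp, bernExp_const, mul_one]
  have hcolor : ∀ η : Finset E,
      ∑ σ, colorWeight ends α (fun f => decide (f ∈ η)) σ * f σ =
        bernExp α (fun c => f (toSpin (wiredSpin ends η ∅ c))) := by
    intro η
    simp only [colorWeight_eq, bernExp, Finset.sum_mul, toSpin_wiredSpin_empty]
    rw [Finset.sum_comm]
    refine Finset.sum_congr rfl fun c _ => ?_
    simp
  simp only [ffpMeasure, rcMeasure, Finset.sum_mul, sum_bool_fun_eq_sum_powerset (E := E)]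
  rw [Finset.sum_comm]
  simp only [mul_assoc, ← Finset.mul_sum, hcolor]
  rw [← sum_bool_fun_eq_sum_powerset (fun τ => rcWeight ends p q τ), hZ]
  generalize wiredSum ends (fun e => p e / (1 - p e)) q α Finset.univ ∅ (fun _ => 1) = N
  rw [wiredSum, Finset.sum_div]
  refine Finset.sum_congr rfl fun η _ => ?_
  rw [rcWeight_eq ends hp, mul_div_mul_left _ _ hP]
  ring

end FuzzyPotts

/-- Theorem 1: any fractional fuzzy Potts measure with `q ≥ 1` is positively
associated. -/
theorem stmt_8 {V E : Type*} [Fintype V] [Fintype E] [DecidableEq V] [DecidableEq E]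
    (ends : E → Sym2 V) (p : E → ℝ) (q α : ℝ)
    (hp : ∀ f, 0 < p f ∧ p f < 1) (hq : 1 ≤ q) (hα : 0 < α ∧ α < 1)
    (A B : Set (V → Bool))
    (hA : ∀ σ τ : V → Bool, σ ≤ τ → σ ∈ A → τ ∈ A)
    (hB : ∀ σ τ : V → Bool, σ ≤ τ → σ ∈ B → τ ∈ B) :
    (∑ σ ∈ Finset.univ.filter (fun σ : V → Bool => σ ∈ A ∩ B), ffpMeasure ends p q α σ) ≥
      (∑ σ ∈ Finset.univ.filter (fun σ : V → Bool => σ ∈ A), ffpMeasure ends p q α σ) *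
        (∑ σ ∈ Finset.univ.filter (fun σ : V → Bool => σ ∈ B), ffpMeasure ends p q α σ) := by
  have hy : ∀ e, 0 < p e / (1 - p e) := fun e => div_pos (hp e).1 (sub_pos.2 (hp e).2)
  have hsum : ∀ (C : Set (V → Bool)) [DecidablePred (· ∈ C)],
      ∑ σ ∈ Finset.univ.filter (fun σ : V → Bool => σ ∈ C), ffpMeasure ends p q α σ =
        ∑ σ, ffpMeasure ends p q α σ * C.indicator 1 σ := by
    intro C _
    rw [Finset.sum_filter]
    refine Finset.sum_congr rfl fun σ _ => ?_
    by_cases h : σ ∈ C <;> simp [h]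
  have hmono : ∀ C : Set (V → Bool), (∀ σ τ : V → Bool, σ ≤ τ → σ ∈ C → τ ∈ C) →
      Monotone (fun ω : V → WithTop Bool => C.indicator (1 : (V → Bool) → ℝ) (toSpin ω)) := by
    intro C hC ω ω' hω
    by_cases h : toSpin ω ∈ C
    · simp [h, hC _ _ (toSpin_mono hω) h]
    · simp only [Set.indicator_of_notMem h]
      exact Set.indicator_nonneg (fun _ _ => zero_le_one) _
  have hpa := wiredPA (ends := ends) hy hq _ Finset.univ ∅ α rfl hα.1 hα.2 _ _
    (hmono A hA) (hmono B hB)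
  have hpos := wiredSum_one_pos (ends := ends) (α := α) (F := Finset.univ) (W := ∅) hy hq
  rw [hsum, hsum, hsum, ge_iff_le]
  simp only [sum_ffpMeasure_mul ends (fun f => (hp f).2), Set.inter_indicator_one, Pi.mul_apply]
  rw [div_mul_div_comm, div_le_div_iff₀ (mul_pos hpos hpos) hpos]
  have := mul_le_mul_of_nonneg_right hpa hpos.le
  linarith
end

section
/- Let G = (V,E) be a finite graph, ν the fractional fuzzy Potts measure from φ_{p,q} with q ≥ 1 and α ∈ (0,1), x ∈ V, and e ∈ E an edge containing x. Then for any increasing event C ⊆ {±1}^V, C and {η_e = 1} are conditionally positively correlated given {σ_x = 1}: Pr(C ∩ {η_e = 1} | σ_x = 1) ≥ Pr(C | σ_x = 1)·Pr(η_e = 1 | σ_x = 1). -/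
open Finset
open scoped Classical

/-- The joint law of the random-cluster configuration `η` and the fractional fuzzy
Potts spins `σ`, as a weight on pairs. -/
noncomputable def jointW {V E : Type*} [Fintype V] [Fintype E] [DecidableEq E]
    (ends : E → Sym2 V) (p : E → ℝ) (q α : ℝ) (ω : (E → Bool) × (V → Bool)) : ℝ :=
  rcMeasure ends p q ω.1 * colorWeight ends α ω.1 ω.2

section Lemmas

variable {V E : Type*}

lemma openSub_adj (ends : E → Sym2 V) (η : E → Bool) (u v : V) :
    (openSub ends η).Adj u v ↔ (∃ f, η f = true ∧ ends f = s(u, v)) ∧ u ≠ v := by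
  simp [openSub]

lemma openSub_mono (ends : E → Sym2 V) {η τ : E → Bool} (h : η ≤ τ) :
    openSub ends η ≤ openSub ends τ := by
  intro u v
  simp only [openSub_adj]
  rintro ⟨⟨f, hf, hs⟩, hne⟩
  exact ⟨⟨f, h f hf, hs⟩, hne⟩

section Update

variable [DecidableEq E]

lemma le_update_true (η : E → Bool) (e : E) : η ≤ Function.update η e true := by
  intro f
  by_cases h : f = e
  · subst h; simp
  · simp [h]

lemma reachable_update (ends : E → Sym2 V) (η : E → Bool) {e : E} {a b : V}
    (he : ends e = s(a, b)) {u v : V} :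
    (openSub ends (Function.update η e true)).Reachable u v ↔
      (openSub ends η).Reachable u v ∨
      ((openSub ends η).Reachable u a ∧ (openSub ends η).Reachable b v) ∨
      ((openSub ends η).Reachable u b ∧ (openSub ends η).Reachable a v) := by
  have hm := openSub_mono ends (le_update_true η e)
  have hab : (openSub ends (Function.update η e true)).Reachable a b := by
    by_cases h : a = b
    · subst h; rfl
    · exact SimpleGraph.Adj.reachable ((openSub_adj ..).2 ⟨⟨e, by simp, he⟩, h⟩)
  constructor
  · rintro ⟨w⟩
    induction w with
    | nil => exact Or.inl .rfl
    | @cons u w v h p ih =>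
      rw [openSub_adj] at h
      obtain ⟨⟨f, hf, hs⟩, hne⟩ := h
      by_cases hfe : f = e
      · subst hfe
        rw [he, Sym2.eq_iff] at hs
        rcases hs with ⟨rfl, rfl⟩ | ⟨rfl, rfl⟩
        · rcases ih with h | ⟨h1, h2⟩ | ⟨h1, h2⟩
          · exact Or.inr (Or.inl ⟨.rfl, h⟩)
          · exact Or.inr (Or.inl ⟨.rfl, h2⟩)
          · exact Or.inl h2
        · rcases ih with h | ⟨h1, h2⟩ | ⟨h1, h2⟩
          · exact Or.inr (Or.inr ⟨.rfl, h⟩)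
          · exact Or.inl h2
          · exact Or.inr (Or.inr ⟨.rfl, h2⟩)
      · have huw : (openSub ends η).Reachable u w :=
          SimpleGraph.Adj.reachable
            ((openSub_adj ..).2 ⟨⟨f, by simpa [hfe] using hf, hs⟩, hne⟩)
        rcases ih with h | ⟨h1, h2⟩ | ⟨h1, h2⟩
        · exact Or.inl (huw.trans h)
        · exact Or.inr (Or.inl ⟨huw.trans h1, h2⟩)
        · exact Or.inr (Or.inr ⟨huw.trans h1, h2⟩)
  · rintro (h | ⟨h1, h2⟩ | ⟨h1, h2⟩)
    · exact h.mono hm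
    · exact ((h1.mono hm).trans hab).trans (h2.mono hm)
    · exact ((h1.mono hm).trans hab.symm).trans (h2.mono hm)

/-- The map on clusters induced by opening the edge `e`. -/
noncomputable def clusterMap (ends : E → Sym2 V) (η : E → Bool) (e : E) :
    (openSub ends η).ConnectedComponent →
      (openSub ends (Function.update η e true)).ConnectedComponent :=
  SimpleGraph.ConnectedComponent.map
    (SimpleGraph.Hom.ofLE (openSub_mono ends (le_update_true η e)))

lemma clusterMap_mk (ends : E → Sym2 V) (η : E → Bool) (e : E) (v : V) :
    clusterMap ends η e ((openSub ends η).connectedComponentMk v) =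
      (openSub ends (Function.update η e true)).connectedComponentMk v := rfl

lemma clusterMap_surjective (ends : E → Sym2 V) (η : E → Bool) (e : E) :
    Function.Surjective (clusterMap ends η e) := by
  intro K
  induction K using SimpleGraph.ConnectedComponent.ind with
  | h v => exact ⟨_, clusterMap_mk ends η e v⟩

lemma clusterMap_bijective (ends : E → Sym2 V) (η : E → Bool) {e : E} {a b : V}
    (he : ends e = s(a, b)) (hab : (openSub ends η).Reachable a b) :
    Function.Bijective (clusterMap ends η e) := by
  refine ⟨fun K L => ?_, clusterMap_surjective ends η e⟩
  induction K using SimpleGraph.ConnectedComponent.ind with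
  | h u =>
  induction L using SimpleGraph.ConnectedComponent.ind with
  | h v =>
  simp only [clusterMap_mk, SimpleGraph.ConnectedComponent.eq]
  rw [reachable_update ends η he]
  rintro (h | ⟨h1, h2⟩ | ⟨h1, h2⟩)
  · exact h
  · exact (h1.trans hab).trans h2
  · exact (h1.trans hab.symm).trans h2

lemma clusterMap_restrict_bijective (ends : E → Sym2 V) (η : E → Bool) {e : E} {a b : V}
    (he : ends e = s(a, b)) (hab : ¬ (openSub ends η).Reachable a b) :
    Function.Bijective
      (fun K : {K // K ≠ (openSub ends η).connectedComponentMk b} =>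
        clusterMap ends η e K) := by
  constructor
  · rintro ⟨K, hK⟩ ⟨L, hL⟩
    induction K using SimpleGraph.ConnectedComponent.ind with
    | h u =>
    induction L using SimpleGraph.ConnectedComponent.ind with
    | h v =>
    simp only [ne_eq, SimpleGraph.ConnectedComponent.eq, clusterMap_mk, Subtype.mk.injEq]
      at hK hL ⊢
    rw [reachable_update ends η he]
    rintro (h | ⟨h1, h2⟩ | ⟨h1, h2⟩)
    · exact h
    · exact absurd h2.symm hL
    · exact absurd h1 hK
  · intro K
    induction K using SimpleGraph.ConnectedComponent.ind with
    | h v =>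
    by_cases hv : (openSub ends η).Reachable v b
    · refine ⟨⟨(openSub ends η).connectedComponentMk a, ?_⟩, ?_⟩
      · simpa [SimpleGraph.ConnectedComponent.eq] using hab
      · simp only [clusterMap_mk, SimpleGraph.ConnectedComponent.eq]
        rw [reachable_update ends η he]
        exact Or.inr (Or.inl ⟨.rfl, hv.symm⟩)
    · refine ⟨⟨(openSub ends η).connectedComponentMk v, ?_⟩, rfl⟩
      simpa [SimpleGraph.ConnectedComponent.eq] using hv

lemma numComp_update_of_reachable (ends : E → Sym2 V) (η : E → Bool) {e : E} {a b : V}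
    (he : ends e = s(a, b)) (hab : (openSub ends η).Reachable a b) :
    numComp ends (Function.update η e true) = numComp ends η :=
  (Nat.card_congr (Equiv.ofBijective _ (clusterMap_bijective ends η he hab))).symm

lemma numComp_update_of_not_reachable [Finite V] (ends : E → Sym2 V) (η : E → Bool) {e : E} {a b : V}
    (he : ends e = s(a, b)) (hab : ¬ (openSub ends η).Reachable a b) :
    numComp ends (Function.update η e true) + 1 = numComp ends η := by
  have h := Nat.card_congr
    (Equiv.ofBijective _ (clusterMap_restrict_bijective ends η he hab))
  have : Fintype V := Fintype.ofFinite V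
  rw [numComp, numComp, ← h, Nat.card_eq_fintype_card, Nat.card_eq_fintype_card,
    Fintype.card_subtype_compl, Fintype.card_subtype_eq]
  have : 0 < Fintype.card (openSub ends η).ConnectedComponent :=
    Fintype.card_pos_iff.2 ⟨(openSub ends η).connectedComponentMk b⟩
  omega

lemma numComp_update_diff_mono [Finite V] (ends : E → Sym2 V) {η τ : E → Bool} (h : η ≤ τ) (e : E) :
    numComp ends (Function.update η e true) + numComp ends τ ≤
      numComp ends (Function.update τ e true) + numComp ends η := by
  obtain ⟨⟨a, b⟩, he⟩ := Quot.exists_rep (ends e)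
  replace he : ends e = s(a, b) := he.symm
  by_cases h1 : (openSub ends η).Reachable a b
  · have h2 := h1.mono (openSub_mono ends h)
    rw [numComp_update_of_reachable ends η he h1, numComp_update_of_reachable ends τ he h2]
    omega
  · have e1 := numComp_update_of_not_reachable ends η he h1
    by_cases h2 : (openSub ends τ).Reachable a b
    · have e2 := numComp_update_of_reachable ends τ he h2
      omega
    · have e2 := numComp_update_of_not_reachable ends τ he h2
      omega

lemma numComp_supermodular [Finite V] [Fintype E] (ends : E → Sym2 V) (η τ : E → Bool) :
    numComp ends η + numComp ends τ ≤ numComp ends (η ⊓ τ) + numComp ends (η ⊔ τ) := by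
  suffices H : ∀ D : Finset E, numComp ends (fun f => η f && (τ f || decide (f ∈ D))) +
      numComp ends τ ≤ numComp ends (η ⊓ τ) +
        numComp ends (fun f => τ f || (η f && decide (f ∈ D))) by
    have := H univ
    have h1 : (fun f => η f && (τ f || decide (f ∈ (univ : Finset E)))) = η := by
      ext f; simp
    have h2 : (fun f => τ f || (η f && decide (f ∈ (univ : Finset E)))) = η ⊔ τ := by
      ext f; simp [Bool.or_comm]
    rwa [h1, h2] at this
  intro D
  induction D using Finset.induction_on with
  | empty =>
    apply le_of_eq
    congr 2
    all_goals ext f; simp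
  | insert d D hd ih =>
    by_cases hη : η d = true
    · have h1 : (fun f => η f && (τ f || decide (f ∈ insert d D))) =
          Function.update (fun f => η f && (τ f || decide (f ∈ D))) d true := by
        ext f
        by_cases hf : f = d
        · subst hf; simp [hη]
        · simp [hf]
      have h2 : (fun f => τ f || (η f && decide (f ∈ insert d D))) =
          Function.update (fun f => τ f || (η f && decide (f ∈ D))) d true := by
        ext f
        by_cases hf : f = d
        · subst hf; simp [hη]
        · simp [hf]
      rw [h1, h2]
      have hle : (fun f => η f && (τ f || decide (f ∈ D))) ≤
          (fun f => τ f || (η f && decide (f ∈ D))) := by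
        intro f
        change (η f && (τ f || decide (f ∈ D))) ≤ (τ f || (η f && decide (f ∈ D)))
        cases η f <;> cases τ f <;> cases decide (f ∈ D) <;> decide
      have := numComp_update_diff_mono ends hle d
      omega
    · have h1 : (fun f => η f && (τ f || decide (f ∈ insert d D))) =
          (fun f => η f && (τ f || decide (f ∈ D))) := by
        ext f
        by_cases hf : f = d
        · subst hf; simp [hη]
        · simp [hf]
      have h2 : (fun f => τ f || (η f && decide (f ∈ insert d D))) =
          (fun f => τ f || (η f && decide (f ∈ D))) := by
        ext f
        by_cases hf : f = d
        · subst hf; simp [hη]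
        · simp [hf]
      rwa [h1, h2]

/-- Comparing averages: if `S₂/Z₂ ≤ S₃/Z₃`, `S₀/Z₀ ≤ S₁/Z₁ ≤ S₃/Z₃` and
`Z₁ * Z₂ ≤ Z₀ * Z₃`, then `(S₂ + S₀)/(Z₂ + Z₀) ≤ (S₃ + S₁)/(Z₃ + Z₁)`. -/
lemma mixture_mul_le {S₀ S₁ S₂ S₃ Z₀ Z₁ Z₂ Z₃ : ℝ}
    (z0 : 0 < Z₀) (z1 : 0 < Z₁) (z2 : 0 < Z₂) (z3 : 0 < Z₃)
    (h01 : S₀ * Z₁ ≤ S₁ * Z₀) (h23 : S₂ * Z₃ ≤ S₃ * Z₂) (h13 : S₁ * Z₃ ≤ S₃ * Z₁)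
    (hZ : Z₁ * Z₂ ≤ Z₀ * Z₃) :
    (S₂ + S₀) * (Z₃ + Z₁) ≤ (S₃ + S₁) * (Z₂ + Z₀) := by
  rw [← div_le_div_iff₀ z1 z3] at h13
  rw [← div_le_div_iff₀ z0 z1] at h01
  rw [← div_le_div_iff₀ z2 z3] at h23
  obtain ⟨a₀, rfl⟩ : ∃ a, S₀ = a * Z₀ := ⟨S₀ / Z₀, by field_simp⟩
  obtain ⟨a₁, rfl⟩ : ∃ a, S₁ = a * Z₁ := ⟨S₁ / Z₁, by field_simp⟩
  obtain ⟨a₂, rfl⟩ : ∃ a, S₂ = a * Z₂ := ⟨S₂ / Z₂, by field_simp⟩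
  obtain ⟨a₃, rfl⟩ : ∃ a, S₃ = a * Z₃ := ⟨S₃ / Z₃, by field_simp⟩
  simp only [mul_div_cancel_right₀ _ z0.ne', mul_div_cancel_right₀ _ z1.ne',
    mul_div_cancel_right₀ _ z2.ne', mul_div_cancel_right₀ _ z3.ne'] at h01 h23 h13
  calc (a₂ * Z₂ + a₀ * Z₀) * (Z₃ + Z₁) ≤ (a₃ * Z₂ + a₁ * Z₀) * (Z₃ + Z₁) := by gcongr
    _ ≤ (a₃ * Z₃ + a₁ * Z₁) * (Z₂ + Z₀) := by
      nlinarith [mul_nonneg (sub_nonneg.2 h13) (sub_nonneg.2 hZ)]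

lemma div_mul_div_le_of_mul_le {S₀ S₁ Z₀ Z₁ W a : ℝ} (ha : 0 < a) (hW : 0 < W)
    (hsum : W = Z₁ + Z₀) (h : S₀ * Z₁ ≤ S₁ * Z₀) :
    (S₁ + S₀) / W / (W * a / W) * (Z₁ * a / W / (W * a / W)) ≤ S₁ / W / (W * a / W) := by
  have h1 : (S₁ + S₀) / W / (W * a / W) * (Z₁ * a / W / (W * a / W)) =
      (S₁ + S₀) * Z₁ / (W * W * a) := by field_simp
  have h2 : S₁ / W / (W * a / W) = S₁ * W / (W * W * a) := by field_simp
  have h3 : (S₁ + S₀) * Z₁ ≤ S₁ * W := by rw [hsum]; linarith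
  rw [h1, h2]
  exact div_le_div_of_nonneg_right h3 (by positivity)

section Weight

variable [Fintype E]

omit [DecidableEq E] in
lemma rcWeight_pos (ends : E → Sym2 V) {p : E → ℝ} {q : ℝ}
    (hp : ∀ f, 0 < p f ∧ p f < 1) (hq : 0 < q) (η : E → Bool) :
    0 < rcWeight ends p q η := by
  refine mul_pos (prod_pos fun f _ => ?_) (pow_pos hq _)
  split_ifs
  · exact (hp f).1
  · linarith [(hp f).2]

lemma rcWeight_mul_le [Finite V] (ends : E → Sym2 V) {p : E → ℝ} {q : ℝ}
    (hp : ∀ f, 0 < p f ∧ p f < 1) (hq : 1 ≤ q) (η τ : E → Bool) :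
    rcWeight ends p q η * rcWeight ends p q τ ≤
      rcWeight ends p q (η ⊓ τ) * rcWeight ends p q (η ⊔ τ) := by
  have h1 : (∏ f, if (η ⊓ τ) f then p f else 1 - p f) *
      (∏ f, if (η ⊔ τ) f then p f else 1 - p f) =
      (∏ f, if η f then p f else 1 - p f) * (∏ f, if τ f then p f else 1 - p f) := by
    rw [← prod_mul_distrib, ← prod_mul_distrib]
    refine prod_congr rfl fun f _ => ?_
    simp only [Pi.inf_apply, Pi.sup_apply]
    rcases Bool.eq_false_or_eq_true (η f) with h | h <;>
      rcases Bool.eq_false_or_eq_true (τ f) with h' | h' <;> simp [h, h', mul_comm]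
  have h2 : q ^ (numComp ends η + numComp ends τ) ≤
      q ^ (numComp ends (η ⊓ τ) + numComp ends (η ⊔ τ)) :=
    pow_le_pow_right₀ hq (numComp_supermodular ends η τ)
  unfold rcWeight
  rw [mul_mul_mul_comm, ← pow_add, mul_mul_mul_comm, ← pow_add, h1]
  refine mul_le_mul_of_nonneg_left h2 (mul_nonneg ?_ ?_) <;>
  · refine prod_nonneg fun f _ => ?_
    split_ifs
    · exact (hp f).1.le
    · linarith [(hp f).2]

lemma rcWeight_update_mul_comm [Finite V] (ends : E → Sym2 V) (p : E → ℝ) (q : ℝ)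
    {η τ : E → Bool} {e : E} {a b : V} (he : ends e = s(a, b))
    (hη : η e = false) (hτ : τ e = false)
    (h : (openSub ends η).Reachable a b ↔ (openSub ends τ).Reachable a b) :
    rcWeight ends p q (Function.update η e true) * rcWeight ends p q τ =
      rcWeight ends p q η * rcWeight ends p q (Function.update τ e true) := by
  have hprod (ξ : E → Bool) : (∏ f, if ξ f then p f else 1 - p f) =
      (if ξ e then p e else 1 - p e) * ∏ f ∈ univ.erase e, if ξ f then p f else 1 - p f :=
    (mul_prod_erase univ _ (mem_univ e)).symm
  have hupd (ξ : E → Bool) : (∏ f ∈ univ.erase e,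
      if Function.update ξ e true f then p f else 1 - p f) =
      ∏ f ∈ univ.erase e, if ξ f then p f else 1 - p f :=
    prod_congr rfl fun f hf => by rw [Function.update_of_ne (ne_of_mem_erase hf)]
  have hpow : q ^ numComp ends (Function.update η e true) * q ^ numComp ends τ =
      q ^ numComp ends η * q ^ numComp ends (Function.update τ e true) := by
    rw [← pow_add, ← pow_add]
    congr 1
    by_cases hr : (openSub ends η).Reachable a b
    · rw [numComp_update_of_reachable ends η he hr,
        numComp_update_of_reachable ends τ he (h.1 hr)]
    · have h1 := numComp_update_of_not_reachable ends η he hr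
      have h2 := numComp_update_of_not_reachable ends τ he (mt h.2 hr)
      omega
  unfold rcWeight
  rw [mul_mul_mul_comm, hpow, hprod (Function.update η e true), hprod τ, hprod η,
    hprod (Function.update τ e true), hupd, hupd, hη, hτ]
  simp only [Function.update_self]
  ring

/-- The sum of `h` over the configurations that agree with `ξ` outside `F`. -/
noncomputable def cylSum (h : (E → Bool) → ℝ) (F : Finset E) (ξ : E → Bool) : ℝ :=
  ∑ η with ∀ f ∉ F, η f = ξ f, h η

lemma cylSum_split (h : (E → Bool) → ℝ) {F : Finset E} {ξ : E → Bool} {e : E}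
    (heF : e ∈ F) (he : ξ e = false) :
    cylSum h F ξ =
      cylSum h (F.erase e) (Function.update ξ e true) + cylSum h (F.erase e) ξ := by
  unfold cylSum
  rw [← sum_filter_add_sum_filter_not _ (fun η => η e = true)]
  congr 1
  · refine sum_congr ?_ fun _ _ => rfl
    ext η
    simp only [mem_filter, mem_univ, true_and, mem_erase, not_and]
    constructor
    · rintro ⟨h1, h2⟩ f hf
      by_cases hfe : f = e
      · subst hfe; simpa using h2
      · rw [Function.update_of_ne hfe, h1 f (hf hfe)]
    · intro h1
      refine ⟨fun f hf => ?_, by simpa using h1 e (by simp)⟩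
      have hfe : f ≠ e := fun hfe => hf (hfe ▸ heF)
      rw [h1 f fun _ => hf, Function.update_of_ne hfe]
  · refine sum_congr ?_ fun _ _ => rfl
    ext η
    simp only [mem_filter, mem_univ, true_and, mem_erase, not_and, Bool.not_eq_true]
    constructor
    · rintro ⟨h1, h2⟩ f hf
      by_cases hfe : f = e
      · subst hfe; rw [h2, he]
      · exact h1 f (hf hfe)
    · intro h1
      exact ⟨fun f hf => h1 f fun _ => hf, by rw [h1 e (by simp), he]⟩

lemma cylSum_update (h : (E → Bool) → ℝ) {F : Finset E} {ξ : E → Bool} {e : E}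
    (heF : e ∉ F) (he : ξ e = false) :
    cylSum h F (Function.update ξ e true) =
      cylSum (fun η => h (Function.update η e true)) F ξ := by
  unfold cylSum
  refine sum_bij' (fun η _ => Function.update η e false)
    (fun η _ => Function.update η e true) ?_ ?_ ?_ ?_ ?_
  · intro η hη
    simp only [mem_filter, mem_univ, true_and] at hη ⊢
    intro f hf
    by_cases hfe : f = e
    · subst hfe; simp [he]
    · simpa [hfe] using hη f hf
  · intro η hη
    simp only [mem_filter, mem_univ, true_and] at hη ⊢
    intro f hf
    by_cases hfe : f = e
    · subst hfe; simp
    · simpa [hfe] using hη f hf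
  · intro η hη
    simp only [mem_filter, mem_univ, true_and] at hη
    have := hη e heF
    rw [Function.update_self] at this
    rw [Function.update_idem, ← this, Function.update_eq_self]
  · intro η hη
    simp only [mem_filter, mem_univ, true_and] at hη
    have := (hη e heF).trans he
    rw [Function.update_idem, ← this, Function.update_eq_self]
  · intro η hη
    simp only [mem_filter, mem_univ, true_and] at hη
    have := hη e heF
    rw [Function.update_self] at this
    rw [Function.update_idem, ← this, Function.update_eq_self]

lemma cylSum_pos {h : (E → Bool) → ℝ} (hh : ∀ η, 0 < h η) (F : Finset E) (ξ : E → Bool) :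
    0 < cylSum h F ξ :=
  sum_pos (fun η _ => hh η) ⟨ξ, by simp⟩

lemma cylSum_rcWeight_mul_le [Finite V] (ends : E → Sym2 V) {p : E → ℝ} {q : ℝ}
    (hp : ∀ f, 0 < p f ∧ p f < 1) (hq : 1 ≤ q) (F : Finset E) (ξ ζ : E → Bool) :
    cylSum (rcWeight ends p q) F ξ * cylSum (rcWeight ends p q) F ζ ≤
      cylSum (rcWeight ends p q) F (ξ ⊓ ζ) * cylSum (rcWeight ends p q) F (ξ ⊔ ζ) := by
  have hpos := rcWeight_pos ends hp (zero_lt_one.trans_le hq)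
  have hnn (ξ : E → Bool) : (0 : (E → Bool) → ℝ) ≤
      fun η => if ∀ f ∉ F, η f = ξ f then rcWeight ends p q η else 0 := by
    intro η
    dsimp only [Pi.zero_apply]
    split_ifs
    · exact (hpos η).le
    · exact le_rfl
  simp only [cylSum, sum_filter]
  refine four_functions_theorem_univ _ _ _ _ (hnn _) (hnn _) (hnn _) (hnn _) fun η τ => ?_
  by_cases h1 : ∀ f ∉ F, η f = ξ f
  · by_cases h2 : ∀ f ∉ F, τ f = ζ f
    · have h3 : ∀ f ∉ F, (η ⊓ τ) f = (ξ ⊓ ζ) f := fun f hf => by simp [h1 f hf, h2 f hf]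
      have h4 : ∀ f ∉ F, (η ⊔ τ) f = (ξ ⊔ ζ) f := fun f hf => by simp [h1 f hf, h2 f hf]
      rw [if_pos h1, if_pos h2, if_pos h3, if_pos h4]
      exact rcWeight_mul_le ends hp hq η τ
    · rw [if_neg h2, mul_zero]
      exact mul_nonneg (hnn _ _) (hnn _ _)
  · rw [if_neg h1, zero_mul]
    exact mul_nonneg (hnn _ _) (hnn _ _)

/-- The edge `e` has an endpoint in the open cluster of `x`. -/
def Touches (ends : E → Sym2 V) (x : V) (η : E → Bool) (e : E) : Prop :=
  ∃ v ∈ ends e, (openSub ends η).Reachable x v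

omit [DecidableEq E] [Fintype E] in
lemma Touches.mono {ends : E → Sym2 V} {x : V} {η τ : E → Bool} {e : E}
    (h : Touches ends x η e) (hle : η ≤ τ) : Touches ends x τ e :=
  let ⟨v, hv, hr⟩ := h
  ⟨v, hv, hr.mono (openSub_mono ends hle)⟩

omit [DecidableEq E] [Fintype E] in
lemma Touches.exists_ends_eq {ends : E → Sym2 V} {x : V} {η : E → Bool} {e : E}
    (h : Touches ends x η e) :
    ∃ a b, ends e = s(a, b) ∧ (openSub ends η).Reachable x a := by
  obtain ⟨a, ha, hr⟩ := h
  obtain ⟨b, hb⟩ := Sym2.mem_iff_exists.1 ha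
  exact ⟨a, b, hb, hr⟩

omit [DecidableEq E] [Fintype E] in
/-- The cluster of `x` is determined by `ξ` if no edge of `F` touches it. -/
lemma reachable_of_forall_not_touches (ends : E → Sym2 V) {x : V} {F : Finset E}
    {ξ η : E → Bool} (hF : ∀ f ∈ F, ¬ Touches ends x ξ f) (hη : ∀ f ∉ F, η f = ξ f)
    {u v : V} (hu : (openSub ends ξ).Reachable x u) (h : (openSub ends η).Reachable u v) :
    (openSub ends ξ).Reachable x v := by
  obtain ⟨w⟩ := h
  induction w with
  | nil => exact hu
  | cons h _ ih =>
    refine ih (hu.trans ?_)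
    rw [openSub_adj] at h
    obtain ⟨⟨f, hf, hs⟩, hne⟩ := h
    have hfF : f ∉ F := fun hfF => hF f hfF ⟨_, by rw [hs]; exact Sym2.mem_mk_left _ _, hu⟩
    exact SimpleGraph.Adj.reachable ((openSub_adj ..).2 ⟨⟨f, hη f hfF ▸ hf, hs⟩, hne⟩)

/-- If `g` does not decrease when an edge touching the cluster of `x` is opened, then
conditioning such an edge to be open increases the random-cluster expectation of `g`. -/
lemma cylSum_update_mul_le [Finite V] (ends : E → Sym2 V) {p : E → ℝ} {q : ℝ}
    (hp : ∀ f, 0 < p f ∧ p f < 1) (hq : 1 ≤ q) {x : V} {g : (E → Bool) → ℝ}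
    (hg : ∀ η e, Touches ends x η e → g η ≤ g (Function.update η e true))
    (F : Finset E) : ∀ (ξ : E → Bool) (e : E), (∀ f ∈ F, ξ f = false) → e ∉ F →
      ξ e = false → Touches ends x ξ e →
      cylSum (fun η => rcWeight ends p q η * g η) F ξ *
          cylSum (rcWeight ends p q) F (Function.update ξ e true) ≤
        cylSum (fun η => rcWeight ends p q η * g η) F (Function.update ξ e true) *
          cylSum (rcWeight ends p q) F ξ := by
  have hpos := rcWeight_pos ends hp (zero_lt_one.trans_le hq)
  induction F using Finset.strongInduction with
  | H F ih =>
  intro ξ e hξF heF hξe he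
  by_cases hF : ∃ f ∈ F, Touches ends x ξ f
  · obtain ⟨f, hfF, hf⟩ := hF
    have hfe : f ≠ e := fun h => heF (h ▸ hfF)
    have hss := erase_ssubset hfF
    have he' : e ∉ F.erase f := fun h => heF (mem_of_mem_erase h)
    have hf' : f ∉ F.erase f := notMem_erase f F
    have hz : ∀ k ∈ F.erase f, ξ k = false := fun k hk => hξF k (mem_of_mem_erase hk)
    have hupd (d : E) (hd : d ∉ F.erase f) :
        ∀ k ∈ F.erase f, Function.update ξ d true k = false := fun k hk => by
      rw [Function.update_of_ne (by rintro rfl; exact hd hk), hz k hk]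
    have i1 := ih _ hss ξ e hz he' hξe he
    have i2 := ih _ hss (Function.update ξ f true) e (hupd f hf') he'
      (by rw [Function.update_of_ne hfe.symm, hξe]) (he.mono (le_update_true ξ f))
    have i3 := ih _ hss (Function.update ξ e true) f (hupd e he') hf'
      (by rw [Function.update_of_ne hfe, hξF f hfF]) (hf.mono (le_update_true ξ e))
    have i4 := cylSum_rcWeight_mul_le ends hp hq (F.erase f)
      (Function.update ξ e true) (Function.update ξ f true)
    have hinf : Function.update ξ e true ⊓ Function.update ξ f true = ξ := by
      ext k
      rcases eq_or_ne k e with rfl | h1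
      · simp [hfe.symm, hξe]
      · rcases eq_or_ne k f with rfl | h2
        · simp [hfe, hξF k hfF]
        · simp [h1, h2]
    have hsup : Function.update ξ e true ⊔ Function.update ξ f true =
        Function.update (Function.update ξ e true) f true := by
      ext k
      rcases eq_or_ne k e with rfl | h1
      · simp [hfe.symm]
      · rcases eq_or_ne k f with rfl | h2
        · simp
        · simp [h1, h2]
    rw [hinf, hsup] at i4
    rw [Function.update_comm hfe] at i2
    rw [cylSum_split _ hfF (hξF f hfF), cylSum_split _ hfF (hξF f hfF),
      cylSum_split _ hfF (e := f) (ξ := Function.update ξ e true)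
        (by rw [Function.update_of_ne hfe, hξF f hfF]),
      cylSum_split _ hfF (e := f) (ξ := Function.update ξ e true)
        (by rw [Function.update_of_ne hfe, hξF f hfF])]
    have z0 := cylSum_pos hpos (F.erase f) ξ
    have z1 := cylSum_pos hpos (F.erase f) (Function.update ξ e true)
    have z2 := cylSum_pos hpos (F.erase f) (Function.update ξ f true)
    have z3 := cylSum_pos hpos (F.erase f)
      (Function.update (Function.update ξ e true) f true)
    generalize cylSum (rcWeight ends p q) (F.erase f) ξ = Z₀ at *
    generalize cylSum (rcWeight ends p q) (F.erase f) (Function.update ξ e true) = Z₁ at *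
    generalize cylSum (rcWeight ends p q) (F.erase f) (Function.update ξ f true) = Z₂ at *
    generalize cylSum (rcWeight ends p q) (F.erase f)
      (Function.update (Function.update ξ e true) f true) = Z₃ at *
    exact mixture_mul_le z0 z1 z2 z3 i1 i2 i3 i4
  · push Not at hF
    obtain ⟨a, b, hab, hxa⟩ := he.exists_ends_eq
    rw [cylSum_update _ heF hξe, cylSum_update _ heF hξe]
    simp only [cylSum]
    rw [sum_mul_sum, sum_mul_sum]
    refine sum_le_sum fun η hη => sum_le_sum fun τ hτ => ?_
    simp only [mem_filter, mem_univ, true_and] at hη hτ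
    have hle {η : E → Bool} (hη : ∀ f ∉ F, η f = ξ f) : ξ ≤ η := fun f => by
      by_cases hf : f ∈ F
      · rw [hξF f hf]; exact Bool.false_le _
      · rw [hη f hf]
    have hiff {η : E → Bool} (hη : ∀ f ∉ F, η f = ξ f) :
        (openSub ends η).Reachable a b ↔ (openSub ends ξ).Reachable a b :=
      ⟨fun h => hxa.symm.trans (reachable_of_forall_not_touches ends hF hη hxa h),
        fun h => h.mono (openSub_mono ends (hle hη))⟩
    have hcomm := rcWeight_update_mul_comm ends p q hab ((hη e heF).trans hξe)
      ((hτ e heF).trans hξe) ((hiff hη).trans (hiff hτ).symm)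
    have hmono := hg η e (he.mono (hle hη))
    calc rcWeight ends p q η * g η * rcWeight ends p q (Function.update τ e true)
        = rcWeight ends p q (Function.update η e true) * rcWeight ends p q τ * g η := by
          rw [hcomm]; ring
      _ ≤ rcWeight ends p q (Function.update η e true) * rcWeight ends p q τ *
          g (Function.update η e true) :=
          mul_le_mul_of_nonneg_left hmono (mul_pos (hpos _) (hpos _)).le
      _ = _ := by ring

end Weight

section Color

variable [Fintype V] [DecidableEq V]

/-- The probability that the cluster spins of `η` produce a configuration in `P`, as a sum
over the spins of the clusters. -/
noncomputable def clusterSpinSum (ends : E → Sym2 V) (α : ℝ) (P : Set (V → Bool))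
    (η : E → Bool) : ℝ :=
  ∑ s : (openSub ends η).ConnectedComponent → Bool,
    if s ∘ (openSub ends η).connectedComponentMk ∈ P then ∏ K, if s K then α else 1 - α else 0

omit [DecidableEq E] in
lemma sum_colorWeight (ends : E → Sym2 V) (α : ℝ) (P : Set (V → Bool)) (η : E → Bool) :
    ∑ σ with σ ∈ P, colorWeight ends α η σ = clusterSpinSum ends α P η := by
  rw [sum_filter, clusterSpinSum, eq_comm]
  have hsurj : Function.Surjective (openSub ends η).connectedComponentMk :=
    fun K => K.exists_rep
  refine Fintype.sum_of_injective (fun s => s ∘ (openSub ends η).connectedComponentMk)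
    hsurj.injective_comp_right _ _ ?_ ?_
  · intro σ hσ
    refine ite_eq_right_iff.2 fun _ => ?_
    rw [colorWeight, if_neg fun h => hσ ⟨SimpleGraph.ConnectedComponent.lift σ fun v w p _ => h v w p.reachable, rfl⟩]
  · intro s
    congr 1
    rw [colorWeight, if_pos]
    · have hcard (c : Bool) : Nat.card {K : (openSub ends η).ConnectedComponent //
          ∃ v, (openSub ends η).connectedComponentMk v = K ∧
            (s ∘ (openSub ends η).connectedComponentMk) v = c} =
          #{K : (openSub ends η).ConnectedComponent | s K = c} := by
        rw [Nat.card_eq_fintype_card, Fintype.card_subtype]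
        congr 1
        ext K
        simp only [mem_filter, mem_univ, true_and, Function.comp_apply]
        constructor
        · rintro ⟨v, rfl, h⟩
          exact h
        · intro h
          obtain ⟨v, rfl⟩ := hsurj K
          exact ⟨v, rfl, h⟩
      rw [hcard, hcard, prod_ite, prod_const, prod_const]
      simp only [Bool.not_eq_true]
    · intro u v h
      simp only [Function.comp_apply, SimpleGraph.ConnectedComponent.eq.2 h]

omit [DecidableEq E] in
lemma clusterSpinSum_apply_eq_true (ends : E → Sym2 V) (α : ℝ) (x : V) (η : E → Bool) :
    clusterSpinSum ends α {σ | σ x = true} η = α := by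
  set X := (openSub ends η).connectedComponentMk x with hX
  have h := prod_univ_sum
    (fun K : (openSub ends η).ConnectedComponent => if K = X then {true} else univ)
    (fun _ c => if c then α else 1 - α)
  have hs : Fintype.piFinset
      (fun K : (openSub ends η).ConnectedComponent =>
        if K = X then ({true} : Finset Bool) else univ) =
      univ.filter fun s => s X = true := by
    ext s
    simp only [Fintype.mem_piFinset, mem_filter, mem_univ, true_and]
    constructor
    · intro h
      simpa using h X
    · intro h K
      split_ifs with hK
      · simp [hK, h]
      · exact mem_univ _
  rw [hs, sum_filter] at h
  rw [clusterSpinSum]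
  refine (sum_congr rfl fun s _ => by congr).trans (h.symm.trans ?_)
  rw [Fintype.prod_eq_single X fun K hK => by simp [hK]]
  simp

/-- Opening an edge that touches the cluster of `x` increases the probability of an
increasing event together with a plus spin at `x`. -/
lemma clusterSpinSum_le_update (ends : E → Sym2 V) {α : ℝ} (hα : 0 < α ∧ α < 1) (x : V)
    {C : Set (V → Bool)} (hC : ∀ σ τ : V → Bool, σ ≤ τ → σ ∈ C → τ ∈ C)
    (η : E → Bool) (e : E) (he : Touches ends x η e) :
    clusterSpinSum ends α {σ | σ ∈ C ∧ σ x = true} η ≤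
      clusterSpinSum ends α {σ | σ ∈ C ∧ σ x = true} (Function.update η e true) := by
  obtain ⟨a, b, hab, hxa⟩ := he.exists_ends_eq
  unfold clusterSpinSum
  by_cases hr : (openSub ends η).Reachable a b
  · let φ := Equiv.ofBijective _ (clusterMap_bijective ends η hab hr)
    apply le_of_eq
    rw [← (φ.symm.arrowCongr (Equiv.refl Bool)).sum_comp]
    refine sum_congr rfl fun s _ => ?_
    rw [← φ.prod_comp]
    rfl
  · let B := (openSub ends η).connectedComponentMk b
    let φ : {K // K ≠ B} ≃ _ :=
      Equiv.ofBijective _ (clusterMap_restrict_bijective ends η hab hr)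
    let ψ := (Equiv.funSplitAt B Bool).trans
      ((Equiv.refl Bool).prodCongr (φ.arrowCongr (Equiv.refl Bool)))
    have hψ (c : Bool) (t) :
        ψ.symm (c, t) = Function.update (t ∘ clusterMap ends η e) B c := by
      ext K
      by_cases hK : K = B
      · subst hK
        simp [ψ, Equiv.funSplitAt, Equiv.piSplitAt]
      · simp [ψ, Equiv.funSplitAt, Equiv.piSplitAt, hK, φ, Equiv.arrowCongr]
    have hw (c : Bool) : 0 ≤ if c then α else 1 - α := by
      split_ifs
      · exact hα.1.le
      · linarith [hα.2]
    rw [← ψ.symm.sum_comp, Fintype.sum_prod_type_right]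
    refine sum_le_sum fun t _ => ?_
    have hprod (c : Bool) : (∏ K, if ψ.symm (c, t) K then α else 1 - α) =
        (if c then α else 1 - α) * ∏ K, if t K then α else 1 - α := by
      rw [Fintype.prod_eq_mul_prod_subtype_ne _ B, ← φ.prod_comp]
      congr 1
      · simp [hψ]
      · refine prod_congr rfl fun K _ => ?_
        rw [hψ, Function.update_of_ne K.2]
        rfl
    simp only [hprod]
    have hmem (c : Bool)
        (h : ψ.symm (c, t) ∘ (openSub ends η).connectedComponentMk ∈
          {σ | σ ∈ C ∧ σ x = true}) :
        t ∘ (openSub ends (Function.update η e true)).connectedComponentMk ∈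
          {σ : V → Bool | σ ∈ C ∧ σ x = true} := by
      have hxB : (openSub ends η).connectedComponentMk x ≠ B := fun h =>
        hr (hxa.symm.trans (SimpleGraph.ConnectedComponent.eq.1 h))
      have htx : t ((openSub ends (Function.update η e true)).connectedComponentMk x) =
          true := by
        have := h.2
        rwa [Function.comp_apply, hψ, Function.update_of_ne hxB] at this
      refine ⟨hC _ _ (fun v => ?_) h.1, htx⟩
      simp only [Function.comp_apply, hψ]
      by_cases hv : (openSub ends η).connectedComponentMk v = B
      · have : (openSub ends (Function.update η e true)).connectedComponentMk x =
            (openSub ends (Function.update η e true)).connectedComponentMk v := by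
          rw [SimpleGraph.ConnectedComponent.eq, reachable_update ends η hab]
          exact Or.inr (Or.inl ⟨hxa, (SimpleGraph.ConnectedComponent.eq.1 hv).symm⟩)
        rw [← this, htx]
        exact Bool.le_true _
      · rw [Function.update_of_ne hv]
        exact le_rfl
    have hW : 0 ≤ ∏ K, if t K then α else 1 - α := prod_nonneg fun K _ => hw _
    by_cases ht : t ∘ (openSub ends (Function.update η e true)).connectedComponentMk ∈
          {σ : V → Bool | σ ∈ C ∧ σ x = true}
    · rw [if_pos ht]
      calc _ ≤ ∑ c : Bool, (if c then α else 1 - α) * ∏ K, if t K then α else 1 - α := by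
            refine sum_le_sum fun c _ => ?_
            split_ifs with h1 h2 h2
            all_goals first | exact le_rfl | exact mul_nonneg (by linarith [hα.1, hα.2]) hW
        _ = _ := by rw [← sum_mul, Fintype.sum_bool]; simp
    · rw [if_neg ht]
      exact (sum_eq_zero fun c _ => if_neg fun h => ht (hmem c h)).le

end Color

end Update

lemma sum_jointW [Fintype V] [Fintype E] [DecidableEq V] [DecidableEq E] (ends : E → Sym2 V) (p : E → ℝ)
    (q α : ℝ) (R : (E → Bool) × (V → Bool) → Prop) [DecidablePred R]
    (Q : (E → Bool) → Prop) [DecidablePred Q] (P : Set (V → Bool))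
    (hR : ∀ ω, R ω ↔ Q ω.1 ∧ ω.2 ∈ P) :
    ∑ ω with R ω, jointW ends p q α ω =
      (∑ η with Q η, rcWeight ends p q η * clusterSpinSum ends α P η) /
        ∑ τ, rcWeight ends p q τ := by
  have hprod : univ.filter R = univ.filter Q ×ˢ univ.filter (· ∈ P) := by
    ext ω
    simp [hR]
  rw [hprod, sum_product, sum_div]
  refine sum_congr rfl fun η _ => ?_
  simp only [jointW, rcMeasure]
  rw [← mul_sum, sum_colorWeight]
  ring

end Lemmas

/-- Lemma 2: for an edge `e` containing `x` and an increasing spin event `C`,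
`C` and `{η_e = 1}` are conditionally positively correlated given `{σ_x = 1}`. -/
theorem stmt_10 {V E : Type*} [Fintype V] [Fintype E] [DecidableEq V] [DecidableEq E]
    (ends : E → Sym2 V) (p : E → ℝ) (q α : ℝ)
    (hp : ∀ f, 0 < p f ∧ p f < 1) (hq : 1 ≤ q) (hα : 0 < α ∧ α < 1)
    (x : V) (e : E) (hxe : x ∈ ends e)
    (C : Set (V → Bool))
    (hC : ∀ σ τ : V → Bool, σ ≤ τ → σ ∈ C → τ ∈ C) :
    (∑ ω ∈ Finset.univ.filter
        (fun ω : (E → Bool) × (V → Bool) => ω.2 ∈ C ∧ ω.1 e = true ∧ ω.2 x = true),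
        jointW ends p q α ω) /
      (∑ ω ∈ Finset.univ.filter (fun ω : (E → Bool) × (V → Bool) => ω.2 x = true),
        jointW ends p q α ω) ≥
    ((∑ ω ∈ Finset.univ.filter
        (fun ω : (E → Bool) × (V → Bool) => ω.2 ∈ C ∧ ω.2 x = true),
        jointW ends p q α ω) /
      (∑ ω ∈ Finset.univ.filter (fun ω : (E → Bool) × (V → Bool) => ω.2 x = true),
        jointW ends p q α ω)) *
    ((∑ ω ∈ Finset.univ.filter
        (fun ω : (E → Bool) × (V → Bool) => ω.1 e = true ∧ ω.2 x = true),
        jointW ends p q α ω) /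
      (∑ ω ∈ Finset.univ.filter (fun ω : (E → Bool) × (V → Bool) => ω.2 x = true),
        jointW ends p q α ω)) := by
  have hpos := rcWeight_pos ends hp (zero_lt_one.trans_le hq)
  set w := rcWeight ends p q
  set W := ∑ τ, w τ with hW
  set F := (univ : Finset E).erase e
  let ξ : E → Bool := fun _ => false
  have key := cylSum_update_mul_le ends hp hq
    (clusterSpinSum_le_update ends hα x hC) F ξ e (fun _ _ => rfl) (notMem_erase e univ) rfl
    ⟨x, hxe, .rfl⟩
  have hsplit (h : (E → Bool) → ℝ) : ∑ η, h η =
      cylSum h F (Function.update ξ e true) + cylSum h F ξ := by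
    rw [← cylSum_split h (mem_univ e) rfl]
    simp [cylSum]
  have hopen (h : (E → Bool) → ℝ) : ∑ η with η e = true, h η =
      cylSum h F (Function.update ξ e true) := by
    simp [cylSum, F]
  have hW0 : 0 < W := sum_pos (fun η _ => hpos η) univ_nonempty
  rw [sum_jointW ends p q α (fun ω => ω.2 ∈ C ∧ ω.1 e = true ∧ ω.2 x = true)
      (fun η => η e = true) {σ | σ ∈ C ∧ σ x = true} fun ω => and_left_comm,
    sum_jointW ends p q α (fun ω => ω.2 x = true)
      (fun _ => True) {σ | σ x = true} fun ω => iff_of_eq (true_and _).symm,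
    sum_jointW ends p q α (fun ω => ω.2 ∈ C ∧ ω.2 x = true)
      (fun _ => True) {σ | σ ∈ C ∧ σ x = true} fun ω => iff_of_eq (true_and _).symm,
    sum_jointW ends p q α (fun ω => ω.1 e = true ∧ ω.2 x = true)
      (fun η => η e = true) {σ | σ x = true} fun ω => Iff.rfl]
  simp only [filter_true, clusterSpinSum_apply_eq_true]
  rw [← sum_mul, ← sum_mul, hopen, hopen, hsplit (fun η => rcWeight ends p q η * _)]
  have hWs : W = cylSum w F (Function.update ξ e true) + cylSum w F ξ := hsplit w
  exact div_mul_div_le_of_mul_le hα.1 hW0 hWs key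
end

section
/- Let G = (V,E) be a finite graph, φ any probability measure on {0,1}^E satisfying (i) the positive lattice condition and (ii) the factorization property: for every S ⊆ V, conditioned on the event that no open edge joins S to V\S, the restrictions of the configuration to edges inside S and to edges inside V\S are independent. Then the measure ν_{φ,α} on {±1}^V — obtained by coloring each cluster of the φ-random subgraph independently +1 with probability α ∈ (0,1) — is positively associated. -/
open Finset
open scoped Classical

section ClusterColoring

variable {V E : Type*}

/-- The edge `e` joins `S` to its complement. -/
def Crosses (ends : E → Sym2 V) (S : Set V) (e : E) : Prop :=
  (¬ ∀ v ∈ ends e, v ∈ S) ∧ ¬ ∀ v ∈ ends e, v ∉ S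

/-- Every edge joining `S` to its complement is closed in `η`. -/
def CutClosed (ends : E → Sym2 V) (S : Set V) (η : E → Bool) : Prop :=
  ∀ e, Crosses ends S e → η e = false

/-- The configuration equal to `η` on the edges inside `S` and to `τ` elsewhere. -/
noncomputable def splice (ends : E → Sym2 V) (S : Set V) (η τ : E → Bool) : E → Bool :=
  fun e => if ∀ v ∈ ends e, v ∈ S then η e else τ e

theorem splice_splice (ends : E → Sym2 V) (S : Set V) (η τ : E → Bool) :
    splice ends S (splice ends S η τ) (splice ends S τ η) = η := by
  funext e
  simp only [splice]
  split_ifs <;> rfl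

theorem not_inside_compl_of_inside {ends : E → Sym2 V} {S : Set V} {e : E}
    (h : ∀ v ∈ ends e, v ∈ S) : ¬ ∀ v ∈ ends e, v ∉ S := by
  intro h'
  exact h' _ (Sym2.out_fst_mem _) (h _ (Sym2.out_fst_mem _))

theorem CutClosed.splice {ends : E → Sym2 V} {S : Set V} {η τ : E → Bool}
    (hη : CutClosed ends S η) (hτ : CutClosed ends S τ) :
    CutClosed ends S (splice ends S η τ) := by
  intro e he
  unfold _root_.splice
  split_ifs
  · exact hη e he
  · exact hτ e he

/-- A (not necessarily normalized) measure on `{0,1}^E` satisfying the positive lattice condition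
and, in exchange form, the factorization property across vertex cuts. -/
structure IsFactorizingLattice (ends : E → Sym2 V) (φ : (E → Bool) → ℝ) : Prop where
  nonneg : ∀ η, 0 ≤ φ η
  lattice : ∀ η τ, φ η * φ τ ≤ φ (η ⊓ τ) * φ (η ⊔ τ)
  exchange : ∀ S η τ, CutClosed ends S η → CutClosed ends S τ →
    φ η * φ τ = φ (splice ends S η τ) * φ (splice ends S τ η)

/-- The restriction of the measure `φ` to the event that the state of `e` is `b`. -/
def restrictEdge (φ : (E → Bool) → ℝ) (e : E) (b : Bool) : (E → Bool) → ℝ :=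
  fun η => if η e = b then φ η else 0

theorem IsFactorizingLattice.restrictEdge {ends : E → Sym2 V} {φ : (E → Bool) → ℝ}
    (h : IsFactorizingLattice ends φ) (e : E) (b : Bool) :
    IsFactorizingLattice ends (restrictEdge φ e b) where
  nonneg η := by
    unfold _root_.restrictEdge
    split_ifs
    exacts [h.nonneg η, le_rfl]
  lattice η τ := by
    have key : ∀ ξ, 0 ≤ (if ξ e = b then φ ξ else 0) := fun ξ => by
      split_ifs
      exacts [h.nonneg ξ, le_rfl]
    unfold _root_.restrictEdge
    by_cases h1 : η e = b
    · by_cases h2 : τ e = b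
      · simpa [h1, h2] using h.lattice η τ
      · simpa [h1, h2] using mul_nonneg (key (η ⊓ τ)) (key (η ⊔ τ))
    · simpa [h1] using mul_nonneg (key (η ⊓ τ)) (key (η ⊔ τ))
  exchange S η τ hη hτ := by
    have := h.exchange S η τ hη hτ
    unfold _root_.restrictEdge
    by_cases hS : ∀ v ∈ ends e, v ∈ S
    · have e1 : splice ends S η τ e = η e := if_pos hS
      have e2 : splice ends S τ η e = τ e := if_pos hS
      rw [e1, e2]
      by_cases h1 : η e = b <;> by_cases h2 : τ e = b <;> simp [h1, h2, this]
    · have e1 : splice ends S η τ e = τ e := if_neg hS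
      have e2 : splice ends S τ η e = η e := if_neg hS
      rw [e1, e2]
      by_cases h1 : η e = b <;> by_cases h2 : τ e = b <;> simp [h1, h2, this]

theorem CutClosed.reachable_of_agree {ends : E → Sym2 V} {S : Set V} {η τ : E → Bool}
    (hη : CutClosed ends S η) (h : ∀ e, (∀ v ∈ ends e, v ∉ S) → η e = τ e)
    {v u : V} (hv : v ∉ S) (hr : (openSub ends η).Reachable v u) :
    (openSub ends τ).Reachable v u ∧ u ∉ S := by
  rw [SimpleGraph.reachable_iff_reflTransGen] at hr
  induction hr with
  | refl => exact ⟨SimpleGraph.Reachable.refl _, hv⟩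
  | tail _ hadj ih =>
    rename_i b c _
    obtain ⟨hb, hbS⟩ := ih
    rw [openSub, SimpleGraph.fromEdgeSet_adj] at hadj
    obtain ⟨⟨e, he, hee⟩, hne⟩ := hadj
    have hout : ∀ v ∈ ends e, v ∉ S := by
      by_contra hcon
      have hc : Crosses ends S e := ⟨fun hin => hbS (hin b (by simp [hee])), hcon⟩
      simp [hη e hc] at he
    refine ⟨hb.trans (SimpleGraph.Adj.reachable ?_), hout c (by simp [hee])⟩
    rw [openSub, SimpleGraph.fromEdgeSet_adj]
    exact ⟨⟨e, by rw [← h e hout, he], hee⟩, hne⟩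

/-- A representative of the cluster of `v`, depending only on the vertex set of the cluster. -/
noncomputable def clusterRep (ends : E → Sym2 V) (η : E → Bool) (v : V) : V :=
  @Classical.epsilon V ⟨v⟩ fun u => (openSub ends η).Reachable v u

theorem reachable_clusterRep (ends : E → Sym2 V) (η : E → Bool) (v : V) :
    (openSub ends η).Reachable v (clusterRep ends η v) :=
  Classical.epsilon_spec (p := fun u => (openSub ends η).Reachable v u)
    ⟨v, SimpleGraph.Reachable.refl v⟩

theorem clusterRep_eq_of_reachable_iff {ends : E → Sym2 V} {η τ : E → Bool} {v w : V}
    (h : ∀ u, (openSub ends η).Reachable v u ↔ (openSub ends τ).Reachable w u) :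
    clusterRep ends η v = clusterRep ends τ w := by
  unfold clusterRep
  congr 1
  funext u
  exact propext (h u)

theorem clusterRep_eq_iff {ends : E → Sym2 V} {η : E → Bool} {v w : V} :
    clusterRep ends η v = clusterRep ends η w ↔ (openSub ends η).Reachable v w := by
  constructor
  · intro h
    exact (reachable_clusterRep ends η v).trans (h ▸ (reachable_clusterRep ends η w).symm)
  · intro h
    exact clusterRep_eq_of_reachable_iff fun u => ⟨fun k => h.symm.trans k, fun k => h.trans k⟩

/-- The spin configuration in which clusters meeting `R` have spin `+1` and any other cluster
takes the value of `ω` at its representative. -/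
noncomputable def rootedSpin (ends : E → Sym2 V) (R : Set V) (η : E → Bool) (ω : V → Bool) :
    V → Bool :=
  fun v => if ∃ r ∈ R, (openSub ends η).Reachable v r then true else ω (clusterRep ends η v)

/-- The configuration `σ` with all spins in `R` set to `+1`. -/
noncomputable def raise (R : Set V) (σ : V → Bool) : V → Bool :=
  fun v => if v ∈ R then true else σ v

theorem raise_mono (R : Set V) : Monotone (raise R) := by
  intro σ τ h v
  unfold raise
  split_ifs
  exacts [le_rfl, h v]

theorem rootedSpin_mono {ends : E → Sym2 V} {R R' : Set V} (hR : R ⊆ R') (η : E → Bool)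
    (ω : V → Bool) : rootedSpin ends R η ω ≤ rootedSpin ends R' η ω := by
  intro v
  by_cases h : ∃ r ∈ R, (openSub ends η).Reachable v r
  · have h' : ∃ r ∈ R', (openSub ends η).Reachable v r := by
      obtain ⟨r, hr, hv⟩ := h
      exact ⟨r, hR hr, hv⟩
    simp only [rootedSpin, if_pos h, if_pos h', le_refl]
  · by_cases h' : ∃ r ∈ R', (openSub ends η).Reachable v r
    · simp only [rootedSpin, if_pos h']
      exact Bool.le_true _
    · simp only [rootedSpin, if_neg h, if_neg h', le_refl]

theorem rootedSpin_empty (ends : E → Sym2 V) (η : E → Bool) (ω : V → Bool) :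
    rootedSpin ends ∅ η ω = fun v => ω (clusterRep ends η v) := by
  funext v
  simp [rootedSpin]

theorem CutClosed.exists_reachable_iff {ends : E → Sym2 V} {R : Set V} {η : E → Bool}
    (h : CutClosed ends R η) (v : V) :
    (∃ r ∈ R, (openSub ends η).Reachable v r) ↔ v ∈ R := by
  constructor
  · rintro ⟨r, hr, hv⟩
    by_contra hvR
    exact (h.reachable_of_agree (fun _ _ => rfl) hvR hv).2 hr
  · exact fun hv => ⟨v, hv, SimpleGraph.Reachable.refl v⟩

theorem CutClosed.rootedSpin_eq_raise {ends : E → Sym2 V} {R : Set V} {η : E → Bool}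
    (h : CutClosed ends R η) (ω : V → Bool) :
    rootedSpin ends R η ω = raise R (rootedSpin ends ∅ η ω) := by
  rw [rootedSpin_empty]
  funext v
  simp only [rootedSpin, raise, h.exists_reachable_iff]

theorem CutClosed.rootedSpin_splice {ends : E → Sym2 V} {R : Set V} {η τ : E → Bool}
    (hη : CutClosed ends R η) (hτ : CutClosed ends R τ) (ω : V → Bool) :
    rootedSpin ends R (_root_.splice ends R η τ) ω = rootedSpin ends R τ ω := by
  have hs := hη.splice hτ
  funext v
  simp only [rootedSpin, hs.exists_reachable_iff, hτ.exists_reachable_iff]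
  split_ifs with hv
  · rfl
  · have hag : ∀ e, (∀ v ∈ ends e, v ∉ R) → _root_.splice ends R η τ e = τ e := fun e he =>
      if_neg fun hin => not_inside_compl_of_inside hin he
    rw [clusterRep_eq_of_reachable_iff (τ := τ) (w := v) fun u =>
      ⟨fun k => (hs.reachable_of_agree hag hv k).1,
        fun k => (hτ.reachable_of_agree (fun e he => (hag e he).symm) hv k).1⟩]

theorem rootedSpin_eq_of_open {ends : E → Sym2 V} {R : Set V} {η : E → Bool} {e : E}
    (he : η e = true) (hR : ∃ v ∈ ends e, v ∈ R) (ω : V → Bool) :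
    rootedSpin ends (R ∪ {v | v ∈ ends e}) η ω = rootedSpin ends R η ω := by
  funext v
  have : (∃ r ∈ R ∪ {v | v ∈ ends e}, (openSub ends η).Reachable v r) ↔
      ∃ r ∈ R, (openSub ends η).Reachable v r := by
    constructor
    · rintro ⟨r, hr | hr, hv⟩
      · exact ⟨r, hr, hv⟩
      · obtain ⟨x, hx, hxR⟩ := hR
        refine ⟨x, hxR, ?_⟩
        by_cases hrx : r = x
        · exact hrx ▸ hv
        · refine hv.trans (SimpleGraph.Adj.reachable ?_)
          rw [openSub, SimpleGraph.fromEdgeSet_adj]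
          exact ⟨⟨e, he, ((Sym2.mem_and_mem_iff hrx).1 ⟨hr, hx⟩)⟩, hrx⟩
    · rintro ⟨r, hr, hv⟩
      exact ⟨r, Or.inl hr, hv⟩
  simp only [rootedSpin, this]

/-- A function of edge configuration and spins which is increasing in both, does not depend on the
spins in `D`, and depends on the edges only through the clusters meeting `R`. -/
structure IsRootLocal (ends : E → Sym2 V) (D R : Set V)
    (f : (E → Bool) → (V → Bool) → ℝ) : Prop where
  mono_edge : ∀ σ, Monotone fun η => f η σ
  mono_spin : ∀ η, Monotone (f η)
  ignores : ∀ η σ τ, (∀ v, v ∉ D → σ v = τ v) → f η σ = f η τ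
  local_edge : ∀ S, R ⊆ S → ∀ η τ, CutClosed ends S η → CutClosed ends S τ →
    (∀ e, (∀ v ∈ ends e, v ∈ S) → η e = τ e) → f η = f τ

theorem IsRootLocal.mono_root {ends : E → Sym2 V} {D R R' : Set V}
    {f : (E → Bool) → (V → Bool) → ℝ} (hf : IsRootLocal ends D R f) (h : R ⊆ R') :
    IsRootLocal ends D R' f :=
  { hf with local_edge := fun S hS => hf.local_edge S (h.trans hS) }

theorem isRootLocal_edge (ends : E → Sym2 V) (D : Set V) {R : Set V} {e : E}
    (he : ∀ v ∈ ends e, v ∈ R) :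
    IsRootLocal ends D R fun η _ => if η e = true then 1 else 0 where
  mono_edge _ η τ h := by
    have := h e
    by_cases h1 : η e = true
    · have h2 : τ e = true := top_le_iff.1 (le_of_eq_of_le h1.symm this)
      simp [h1, h2]
    · by_cases h2 : τ e = true <;> simp [h1, h2]
  mono_spin _ _ _ _ := le_rfl
  ignores _ _ _ _ := rfl
  local_edge S hS η τ _ _ h := by
    funext _
    simp only [h e fun v hv => hS (he v hv)]

variable [Fintype V] [Fintype E] [DecidableEq V] [DecidableEq E]

/-- The weight of `ω` under the product Bernoulli measure with parameter `α`. -/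
def bernoulliWeight (α : ℝ) (ω : V → Bool) : ℝ :=
  ∏ v, if ω v = true then α else 1 - α

omit [DecidableEq V] in
theorem bernoulliWeight_nonneg {α : ℝ} (h0 : 0 ≤ α) (h1 : α ≤ 1) (ω : V → Bool) :
    0 ≤ bernoulliWeight α ω := by
  refine Finset.prod_nonneg fun v _ => ?_
  split_ifs <;> linarith

theorem sum_prod_bool (p : V → Bool → ℝ) :
    ∑ ω : V → Bool, ∏ v, p v (ω v) = ∏ v, (p v true + p v false) := by
  have := Finset.prod_univ_sum (fun _ : V => (Finset.univ : Finset Bool)) p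
  simp only [Fintype.piFinset_univ, Fintype.sum_bool] at this
  exact this.symm

theorem sum_bernoulliWeight (α : ℝ) : ∑ ω : V → Bool, bernoulliWeight α ω = 1 := by
  unfold bernoulliWeight
  rw [sum_prod_bool fun _ b => if b = true then α else 1 - α]
  simp

omit [DecidableEq V] in
theorem bernoulliWeight_not (α : ℝ) (ω : V → Bool) :
    bernoulliWeight (1 - α) (fun v => !ω v) = bernoulliWeight α ω := by
  unfold bernoulliWeight
  refine Finset.prod_congr rfl fun v _ => ?_
  by_cases h : ω v = true <;> simp [h]

theorem bernoulliWeight_update (α : ℝ) (ω : V → Bool) (i : V) (b : Bool) :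
    bernoulliWeight α (Function.update ω i b) =
      (if b = true then α else 1 - α) * ∏ v ∈ Finset.univ.erase i,
        if ω v = true then α else 1 - α := by
  unfold bernoulliWeight
  rw [← Finset.mul_prod_erase _ _ (Finset.mem_univ i), Function.update_self]
  congr 1
  refine Finset.prod_congr rfl fun v hv => ?_
  rw [Function.update_of_ne (Finset.ne_of_mem_erase hv)]

theorem sum_bernoulliWeight_resample (α : ℝ) (T : (V → Bool) → ℝ) (i : V) :
    ∑ ω, bernoulliWeight α ω * T ω =
      α * ∑ ω, bernoulliWeight α ω * T (Function.update ω i true) +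
        (1 - α) * ∑ ω, bernoulliWeight α ω * T (Function.update ω i false) := by
  have flip : ∀ g : (V → Bool) → ℝ, ∑ ω, g (Function.update ω i (!ω i)) = ∑ ω, g ω := by
    intro g
    have hinv : Function.Involutive fun ω : V → Bool => Function.update ω i (!ω i) := by
      intro ω
      simp
    exact Equiv.sum_comp hinv.toPerm g
  have double : ∀ g : (V → Bool) → ℝ, 2 * ∑ ω, g ω =
      ∑ ω, (g (Function.update ω i true) + g (Function.update ω i false)) := by
    intro g
    rw [two_mul]
    nth_rewrite 2 [← flip g]
    rw [← Finset.sum_add_distrib]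
    refine Finset.sum_congr rfl fun ω _ => ?_
    cases h : ω i
    · have : Function.update ω i false = ω := by rw [← h, Function.update_eq_self]
      rw [this]
      simp [add_comm]
    · have : Function.update ω i true = ω := by rw [← h, Function.update_eq_self]
      rw [this]
      simp
  have h2 : (2 : ℝ) ≠ 0 := two_ne_zero
  apply mul_left_cancel₀ h2
  rw [mul_add, mul_left_comm, mul_left_comm 2 (1 - α), double, double, double,
    Finset.mul_sum, Finset.mul_sum, ← Finset.sum_add_distrib]
  refine Finset.sum_congr rfl fun ω _ => ?_
  simp only [bernoulliWeight_update, Function.update_idem]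
  simp
  ring

/-- The (unnormalized) expectation of `f` when clusters meeting `R` get spin `+1` and the others
get independent Bernoulli(`α`) spins. -/
noncomputable def rootedSum (ends : E → Sym2 V) (φ : (E → Bool) → ℝ) (α : ℝ) (R : Set V)
    (f : (E → Bool) → (V → Bool) → ℝ) : ℝ :=
  ∑ η, φ η * ∑ ω, bernoulliWeight α ω * f η (rootedSpin ends R η ω)

theorem rootedSum_restrictEdge_add (ends : E → Sym2 V) (φ : (E → Bool) → ℝ) (α : ℝ) (R : Set V)
    (f : (E → Bool) → (V → Bool) → ℝ) (e : E) :
    rootedSum ends (restrictEdge φ e true) α R f + rootedSum ends (restrictEdge φ e false) α R f =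
      rootedSum ends φ α R f := by
  unfold rootedSum restrictEdge
  rw [← Finset.sum_add_distrib]
  refine Finset.sum_congr rfl fun η _ => ?_
  by_cases h : η e = true <;> simp [h]

theorem rootedSum_edge (ends : E → Sym2 V) (φ : (E → Bool) → ℝ) (α : ℝ) (R : Set V)
    (f : (E → Bool) → (V → Bool) → ℝ) (e : E) :
    rootedSum ends φ α R (fun η σ => f η σ * if η e = true then 1 else 0) =
      rootedSum ends (restrictEdge φ e true) α R f := by
  unfold rootedSum restrictEdge
  refine Finset.sum_congr rfl fun η _ => ?_
  by_cases h : η e = true <;> simp [h]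

theorem rootedSum_one (ends : E → Sym2 V) (φ : (E → Bool) → ℝ) (α : ℝ) (R : Set V) :
    rootedSum ends φ α R (fun _ _ => 1) = ∑ η, φ η := by
  simp [rootedSum, sum_bernoulliWeight]

theorem rootedSum_restrictEdge_true (ends : E → Sym2 V) (φ : (E → Bool) → ℝ) (α : ℝ) {R : Set V}
    (f : (E → Bool) → (V → Bool) → ℝ) {e : E} (hR : ∃ v ∈ ends e, v ∈ R) :
    rootedSum ends (restrictEdge φ e true) α (R ∪ {v | v ∈ ends e}) f =
      rootedSum ends (restrictEdge φ e true) α R f := by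
  unfold rootedSum restrictEdge
  refine Finset.sum_congr rfl fun η _ => ?_
  split_ifs with h
  · simp only [rootedSpin_eq_of_open h hR]
  · simp

theorem rootedSum_mono_root {ends : E → Sym2 V} {φ : (E → Bool) → ℝ} {α : ℝ} (h0 : 0 ≤ α)
    (h1 : α ≤ 1) (hφ : ∀ η, 0 ≤ φ η) {f : (E → Bool) → (V → Bool) → ℝ}
    (hf : ∀ η, Monotone (f η)) {R R' : Set V} (hR : R ⊆ R') :
    rootedSum ends φ α R f ≤ rootedSum ends φ α R' f :=
  Finset.sum_le_sum fun η _ => mul_le_mul_of_nonneg_left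
    (Finset.sum_le_sum fun ω _ => mul_le_mul_of_nonneg_left
      (hf η (rootedSpin_mono hR η ω)) (bernoulliWeight_nonneg h0 h1 ω)) (hφ η)

theorem fkg_real {φ : (E → Bool) → ℝ} (hφ : ∀ η, 0 ≤ φ η)
    (hl : ∀ η τ, φ η * φ τ ≤ φ (η ⊓ τ) * φ (η ⊔ τ)) {f g : (E → Bool) → ℝ}
    (hf : Monotone f) (hg : Monotone g) :
    (∑ η, φ η * f η) * (∑ η, φ η * g η) ≤ (∑ η, φ η) * ∑ η, φ η * (f η * g η) := by
  have key := fkg (μ := φ) (f := fun η => f η - f ⊥) (g := fun η => g η - g ⊥) hφ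
    (fun η => sub_nonneg.2 (hf bot_le)) (fun η => sub_nonneg.2 (hg bot_le))
    (fun a b h => sub_le_sub_right (hf h) _) (fun a b h => sub_le_sub_right (hg h) _) hl
  have e1 : ∑ η, φ η * (f η - f ⊥) = ∑ η, φ η * f η - (∑ η, φ η) * f ⊥ := by
    simp only [mul_sub, Finset.sum_sub_distrib, Finset.sum_mul]
  have e2 : ∑ η, φ η * (g η - g ⊥) = ∑ η, φ η * g η - (∑ η, φ η) * g ⊥ := by
    simp only [mul_sub, Finset.sum_sub_distrib, Finset.sum_mul]
  have e3 : ∑ η, φ η * ((f η - f ⊥) * (g η - g ⊥)) = ∑ η, φ η * (f η * g η)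
      - g ⊥ * ∑ η, φ η * f η - f ⊥ * ∑ η, φ η * g η + f ⊥ * g ⊥ * ∑ η, φ η := by
    simp only [Finset.mul_sum, ← Finset.sum_sub_distrib, ← Finset.sum_add_distrib]
    exact Finset.sum_congr rfl fun η _ => by ring
  rw [e1, e2, e3] at key
  linarith

omit [Fintype V] [DecidableEq V] in
theorem IsFactorizingLattice.sum_splice {ends : E → Sym2 V} {φ : (E → Bool) → ℝ}
    (h : IsFactorizingLattice ends φ) {R : Set V} (hR : ∀ η, φ η ≠ 0 → CutClosed ends R η)
    (T : (E → Bool) → ℝ) :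
    ∑ η, φ η * ∑ τ, φ τ * T (splice ends R η τ) = (∑ η, φ η) * ∑ η, φ η * T η := by
  have hex : ∀ η τ, φ η * φ τ = φ (splice ends R η τ) * φ (splice ends R τ η) := by
    intro η τ
    by_cases h1 : φ η * φ τ = 0
    · by_contra hne
      have h2 : φ (splice ends R η τ) * φ (splice ends R τ η) ≠ 0 := fun h0 => hne (h1.trans h0.symm)
      have := h.exchange R _ _ (hR _ (left_ne_zero_of_mul h2)) (hR _ (right_ne_zero_of_mul h2))
      rw [splice_splice, splice_splice] at this
      exact hne this.symm
    · exact h.exchange R η τ (hR _ (left_ne_zero_of_mul h1)) (hR _ (right_ne_zero_of_mul h1))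
  have hinv : Function.Involutive fun p : (E → Bool) × (E → Bool) =>
      (splice ends R p.1 p.2, splice ends R p.2 p.1) := by
    intro p
    simp only [splice_splice]
  have hsum := Equiv.sum_comp hinv.toPerm
    (fun p : (E → Bool) × (E → Bool) => φ p.1 * φ p.2 * T p.1)
  simp only [Function.Involutive.coe_toPerm, ← hex, Fintype.sum_prod_type] at hsum
  calc ∑ η, φ η * ∑ τ, φ τ * T (splice ends R η τ)
      = ∑ η, ∑ τ, φ η * φ τ * T (splice ends R η τ) := by
        simp only [Finset.mul_sum, mul_assoc]
    _ = ∑ η, ∑ τ, φ η * φ τ * T η := hsum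
    _ = (∑ η, φ η) * ∑ η, φ η * T η := by
        rw [Finset.sum_mul_sum, Finset.sum_comm]
        exact Finset.sum_congr rfl fun η _ => Finset.sum_congr rfl fun τ _ => by ring

/-- When the root set is separated from the rest, its edges can be resampled independently. -/
theorem IsFactorizingLattice.rootedSum_eq {ends : E → Sym2 V} {φ : (E → Bool) → ℝ}
    (h : IsFactorizingLattice ends φ) {R : Set V} (hR : ∀ η, φ η ≠ 0 → CutClosed ends R η)
    (α : ℝ) {f : (E → Bool) → (V → Bool) → ℝ}
    (hf : ∀ η τ, CutClosed ends R η → CutClosed ends R τ →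
      (∀ e, (∀ v ∈ ends e, v ∈ R) → η e = τ e) → f η = f τ) :
    (∑ η, φ η) * rootedSum ends φ α R f =
      ∑ η, φ η * rootedSum ends φ α ∅ fun _ σ => f η (raise R σ) := by
  unfold rootedSum
  rw [← h.sum_splice hR]
  refine Finset.sum_congr rfl fun η _ => ?_
  by_cases hη : φ η = 0
  · simp [hη]
  congr 1
  refine Finset.sum_congr rfl fun τ _ => ?_
  by_cases hτ : φ τ = 0
  · simp [hτ]
  congr 1
  refine Finset.sum_congr rfl fun ω _ => ?_
  rw [(hR η hη).rootedSpin_splice (hR τ hτ), (hR τ hτ).rootedSpin_eq_raise,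
    hf (splice ends R η τ) η ((hR η hη).splice (hR τ hτ)) (hR η hη) fun e he => if_pos he]

/-- Positive association of the unrooted coloring for functions of the spins outside `D`. -/
def FreeAssociated (V E : Type*) [Fintype V] [Fintype E] [DecidableEq V] [DecidableEq E]
    (ends : E → Sym2 V) (D : Set V) : Prop :=
  ∀ (φ : (E → Bool) → ℝ) (α : ℝ), 0 ≤ α → α ≤ 1 → IsFactorizingLattice ends φ →
    ∀ f g : (V → Bool) → ℝ, Monotone f → Monotone g →
    (∀ σ τ, (∀ v, v ∉ D → σ v = τ v) → f σ = f τ) →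
    (∀ σ τ, (∀ v, v ∉ D → σ v = τ v) → g σ = g τ) →
    rootedSum ends φ α ∅ (fun _ => f) * rootedSum ends φ α ∅ (fun _ => g) ≤
      (∑ η, φ η) * rootedSum ends φ α ∅ fun _ σ => f σ * g σ

theorem rootedSum_mul_le_of_cutClosed {ends : E → Sym2 V} {D R : Set V}
    (hfree : FreeAssociated V E ends (D ∪ R)) {φ : (E → Bool) → ℝ} {α : ℝ} (h0 : 0 ≤ α)
    (h1 : α ≤ 1) (hφ : IsFactorizingLattice ends φ) (hR : ∀ η, φ η ≠ 0 → CutClosed ends R η)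
    {f g : (E → Bool) → (V → Bool) → ℝ} (hf : IsRootLocal ends D R f)
    (hg : IsRootLocal ends D R g) :
    rootedSum ends φ α R f * rootedSum ends φ α R g ≤
      (∑ η, φ η) * rootedSum ends φ α R fun η σ => f η σ * g η σ := by
  have hZ : 0 ≤ ∑ η, φ η := Finset.sum_nonneg fun η _ => hφ.nonneg η
  rcases hZ.eq_or_lt with hZ | hZ
  · have hz : ∀ η, φ η = 0 := fun η =>
      (Finset.sum_eq_zero_iff_of_nonneg fun η _ => hφ.nonneg η).1 hZ.symm η (Finset.mem_univ η)
    simp [rootedSum, hz]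
  have hmono : ∀ {k : (E → Bool) → (V → Bool) → ℝ}, IsRootLocal ends D R k →
      Monotone fun η => rootedSum ends φ α ∅ fun _ σ => k η (raise R σ) := by
    intro k hk η τ hle
    exact Finset.sum_le_sum fun ξ _ => mul_le_mul_of_nonneg_left
      (Finset.sum_le_sum fun ω _ => mul_le_mul_of_nonneg_left
        (hk.mono_edge _ hle) (bernoulliWeight_nonneg h0 h1 ω)) (hφ.nonneg ξ)
  have hign : ∀ {k : (E → Bool) → (V → Bool) → ℝ}, IsRootLocal ends D R k → ∀ η σ τ,
      (∀ v, v ∉ D ∪ R → σ v = τ v) → k η (raise R σ) = k η (raise R τ) := by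
    intro k hk η σ τ hστ
    refine hk.ignores _ _ _ fun v hv => ?_
    unfold raise
    split_ifs with hvR
    · rfl
    · exact hστ v (by simp [hv, hvR])
  have ef := hφ.rootedSum_eq hR α (hf.local_edge R subset_rfl)
  have eg := hφ.rootedSum_eq hR α (hg.local_edge R subset_rfl)
  have efg := hφ.rootedSum_eq hR α (f := fun η σ => f η σ * g η σ) fun η τ hη hτ hag => by
    rw [hf.local_edge R subset_rfl η τ hη hτ hag, hg.local_edge R subset_rfl η τ hη hτ hag]
  have hin : ∀ η, rootedSum ends φ α ∅ (fun _ σ => f η (raise R σ)) *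
      rootedSum ends φ α ∅ (fun _ σ => g η (raise R σ)) ≤
      (∑ η, φ η) * rootedSum ends φ α ∅ fun _ σ => f η (raise R σ) * g η (raise R σ) := fun η =>
    hfree φ α h0 h1 hφ _ _ ((hf.mono_spin η).comp (raise_mono R))
      ((hg.mono_spin η).comp (raise_mono R)) (hign hf η) (hign hg η)
  have hfkg := fkg_real hφ.nonneg hφ.lattice (hmono hf) (hmono hg)
  have hsum : ∑ η, φ η * (rootedSum ends φ α ∅ (fun _ σ => f η (raise R σ)) *
      rootedSum ends φ α ∅ (fun _ σ => g η (raise R σ))) ≤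
      (∑ η, φ η) * ((∑ η, φ η) * rootedSum ends φ α R fun η σ => f η σ * g η σ) := by
    rw [efg, Finset.mul_sum]
    refine Finset.sum_le_sum fun η _ => ?_
    have := mul_le_mul_of_nonneg_left (hin η) (hφ.nonneg η)
    rwa [mul_left_comm _ (∑ η, φ η)] at this
  have hfin := hfkg.trans (mul_le_mul_of_nonneg_left hsum hZ.le)
  rw [← ef, ← eg] at hfin
  refine le_of_mul_le_mul_left ?_ (mul_pos hZ hZ)
  linarith

theorem mixture_mul_le_s14 {Z₀ Z₁ a₀ a₁ b₀ b₁ c₀ c₁ : ℝ} (h₀ : 0 < Z₀) (h₁ : 0 < Z₁)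
    (hc₀ : a₀ * b₀ ≤ Z₀ * c₀) (hc₁ : a₁ * b₁ ≤ Z₁ * c₁)
    (ha : a₀ * Z₁ ≤ a₁ * Z₀) (hb : b₀ * Z₁ ≤ b₁ * Z₀) :
    (a₁ + a₀) * (b₁ + b₀) ≤ (Z₁ + Z₀) * (c₁ + c₀) := by
  refine le_of_mul_le_mul_left ?_ (mul_pos h₀ h₁)
  have k1 := mul_nonneg (sub_nonneg.2 ha) (sub_nonneg.2 hb)
  have k2 := mul_le_mul_of_nonneg_left hc₀ (mul_pos h₁ (add_pos h₁ h₀)).le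
  have k3 := mul_le_mul_of_nonneg_left hc₁ (mul_pos h₀ (add_pos h₁ h₀)).le
  nlinarith

/-- Positive association when the clusters meeting `R` are forced to have spin `+1`. -/
theorem rootedSum_mul_le {ends : E → Sym2 V} {D : Set V} (n : ℕ) :
    ∀ (R : Set V), (∀ R', R ⊆ R' → FreeAssociated V E ends (D ∪ R')) →
    ∀ (φ : (E → Bool) → ℝ) (α : ℝ), 0 ≤ α → α ≤ 1 → IsFactorizingLattice ends φ →
    (Rᶜ.ncard + {e : E | ∃ η, φ η ≠ 0 ∧ η e = true}.ncard ≤ n) →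
    ∀ f g : (E → Bool) → (V → Bool) → ℝ, IsRootLocal ends D R f → IsRootLocal ends D R g →
    rootedSum ends φ α R f * rootedSum ends φ α R g ≤
      (∑ η, φ η) * rootedSum ends φ α R fun η σ => f η σ * g η σ := by
  induction n using Nat.strong_induction_on with
  | _ n ih =>
  intro R hfree φ α h0 h1 hφ hn f g hf hg
  by_cases hR : ∀ η, φ η ≠ 0 → CutClosed ends R η
  · exact rootedSum_mul_le_of_cutClosed (hfree R subset_rfl) h0 h1 hφ hR hf hg
  obtain ⟨e, he, η₁, hη₁, heη₁⟩ : ∃ e, Crosses ends R e ∧ ∃ η, φ η ≠ 0 ∧ η e = true := by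
    simp only [CutClosed] at hR
    push Not at hR
    obtain ⟨η, hη, e, he, h⟩ := hR
    exact ⟨e, he, η, hη, by simpa using h⟩
  set R' : Set V := R ∪ {v | v ∈ ends e} with hR'
  have hsub : R ⊆ R' := Set.subset_union_left
  have hmeet : ∃ v ∈ ends e, v ∈ R := by
    have := he.2
    push Not at this
    exact this
  have hcard : R'ᶜ.ncard < Rᶜ.ncard := by
    have := he.1
    push Not at this
    obtain ⟨y, hy, hyR⟩ := this
    refine Set.ncard_lt_ncard ⟨Set.compl_subset_compl.2 hsub, fun hc => ?_⟩ (Set.toFinite _)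
    exact hc hyR (Or.inr hy)
  have hsupp : ∀ b, {e' : E | ∃ η, restrictEdge φ e b η ≠ 0 ∧ η e' = true} ⊆
      {e' : E | ∃ η, φ η ≠ 0 ∧ η e' = true} := by
    rintro b e' ⟨η, hη, he'⟩
    refine ⟨η, fun hz => hη ?_, he'⟩
    simp [restrictEdge, hz]
  have hcard₁ := Set.ncard_le_ncard (hsupp true) (Set.toFinite _)
  have hcard₀ : {e' : E | ∃ η, restrictEdge φ e false η ≠ 0 ∧ η e' = true}.ncard <
      {e' : E | ∃ η, φ η ≠ 0 ∧ η e' = true}.ncard := by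
    refine Set.ncard_lt_ncard ⟨hsupp false, fun hc => ?_⟩ (Set.toFinite _)
    obtain ⟨η, hη, he'⟩ := hc (show e ∈ _ from ⟨η₁, hη₁, heη₁⟩)
    exact hη (by simp [restrictEdge, he'])
  have hφ₁ := hφ.restrictEdge e true
  have hφ₀ := hφ.restrictEdge e false
  have hfree' : ∀ S, R' ⊆ S → FreeAssociated V E ends (D ∪ S) := fun S hS =>
    hfree S (hsub.trans hS)
  have hopen := ih _ (by omega) R' hfree' _ α h0 h1 hφ₁ le_rfl f g
    (hf.mono_root hsub) (hg.mono_root hsub)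
  simp only [hR', rootedSum_restrictEdge_true ends φ α _ hmeet] at hopen
  have hclosed := ih _ (by omega) R hfree _ α h0 h1 hφ₀ le_rfl f g hf hg
  have hZ : ∑ η, φ η = (∑ η, restrictEdge φ e true η) + ∑ η, restrictEdge φ e false η := by
    rw [← rootedSum_one ends φ α R, ← rootedSum_one ends _ α R, ← rootedSum_one ends _ α R,
      rootedSum_restrictEdge_add]
  have hcross : ∀ {k}, IsRootLocal ends D R k →
      rootedSum ends (restrictEdge φ e false) α R k * (∑ η, restrictEdge φ e true η) ≤
      rootedSum ends (restrictEdge φ e true) α R k * (∑ η, restrictEdge φ e false η) := by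
    intro k hk
    have key := ih _ (by omega) R' hfree' φ α h0 h1 hφ le_rfl k _ (hk.mono_root hsub)
      (isRootLocal_edge ends D (R := R') (e := e) fun v hv => Or.inr hv)
    have hone := rootedSum_edge ends φ α R' (fun _ _ => 1) e
    simp only [one_mul, rootedSum_one] at hone
    rw [rootedSum_edge, hone, ← rootedSum_restrictEdge_add ends φ α R' k e, hZ, hR',
      rootedSum_restrictEdge_true ends φ α k hmeet] at key
    have hmono := rootedSum_mono_root (ends := ends) h0 h1 hφ₀.nonneg hk.mono_spin hsub
    have hZ₁ : 0 ≤ ∑ η, restrictEdge φ e true η := Finset.sum_nonneg fun η _ => hφ₁.nonneg η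
    have := mul_le_mul_of_nonneg_right hmono hZ₁
    rw [hR'] at this
    linarith
  have hZ₁ : 0 < ∑ η, restrictEdge φ e true η := by
    refine Finset.sum_pos' (fun η _ => hφ₁.nonneg η) ⟨η₁, Finset.mem_univ _, ?_⟩
    simpa [restrictEdge, heη₁] using lt_of_le_of_ne (hφ.nonneg η₁) hη₁.symm
  have hZ₀ : 0 ≤ ∑ η, restrictEdge φ e false η := Finset.sum_nonneg fun η _ => hφ₀.nonneg η
  rw [hZ, ← rootedSum_restrictEdge_add ends φ α R f e, ← rootedSum_restrictEdge_add ends φ α R g e,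
    ← rootedSum_restrictEdge_add ends φ α R _ e]
  rcases hZ₀.eq_or_lt with hZ₀ | hZ₀
  · have hz : ∀ η, restrictEdge φ e false η = 0 := fun η =>
      (Finset.sum_eq_zero_iff_of_nonneg fun η _ => hφ₀.nonneg η).1 hZ₀.symm η (Finset.mem_univ η)
    have hv : ∀ k, rootedSum ends (restrictEdge φ e false) α R k = 0 := fun k => by
      simp [rootedSum, hz]
    simpa [hv, ← hZ₀] using hopen
  · exact mixture_mul_le_s14 hZ₀ hZ₁ hclosed hopen (hcross hf) (hcross hg)

omit [Fintype E] [DecidableEq E] in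
theorem rootedSpin_singleton (ends : E → Sym2 V) (y : V) (η : E → Bool) (ω : V → Bool) :
    rootedSpin ends {y} η ω =
      rootedSpin ends ∅ η (Function.update ω (clusterRep ends η y) true) := by
  funext v
  rw [rootedSpin_empty]
  simp only [rootedSpin, Set.mem_singleton_iff, exists_eq_left, Function.update_apply,
    clusterRep_eq_iff]

omit [Fintype E] [DecidableEq E] in
theorem rootedSpin_empty_update_false (ends : E → Sym2 V) (y : V) (η : E → Bool) (ω : V → Bool) :
    rootedSpin ends ∅ η (Function.update ω (clusterRep ends η y) false) =
      fun v => !rootedSpin ends {y} η (fun v => !ω v) v := by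
  funext v
  rw [rootedSpin_singleton, rootedSpin_empty, rootedSpin_empty]
  by_cases h : clusterRep ends η v = clusterRep ends η y <;> simp [h]

/-- Conditioning on the spin of the vertex `y`. -/
theorem rootedSum_empty_eq (ends : E → Sym2 V) (φ : (E → Bool) → ℝ) (α : ℝ) (y : V)
    (f : (V → Bool) → ℝ) :
    rootedSum ends φ α ∅ (fun _ => f) = α * rootedSum ends φ α {y} (fun _ => f) +
      (1 - α) * rootedSum ends φ (1 - α) {y} fun _ σ => f fun v => !σ v := by
  unfold rootedSum
  rw [Finset.mul_sum, Finset.mul_sum, ← Finset.sum_add_distrib]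
  refine Finset.sum_congr rfl fun η _ => ?_
  rw [sum_bernoulliWeight_resample α _ (clusterRep ends η y)]
  simp only [← rootedSpin_singleton, rootedSpin_empty_update_false]
  have hinv : Function.Involutive fun (ω : V → Bool) v => !ω v := fun ω => by simp
  have := Equiv.sum_comp hinv.toPerm fun ω : V → Bool =>
    bernoulliWeight (1 - α) ω * f fun v => !rootedSpin ends {y} η ω v
  simp only [Function.Involutive.coe_toPerm, bernoulliWeight_not] at this
  rw [this]
  ring

theorem rootedSum_not_le {ends : E → Sym2 V} {φ : (E → Bool) → ℝ} {α : ℝ} (h0 : 0 ≤ α)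
    (h1 : α ≤ 1) (hφ : ∀ η, 0 ≤ φ η) (y : V) {f : (V → Bool) → ℝ} (hf : Monotone f) :
    rootedSum ends φ (1 - α) {y} (fun _ σ => f fun v => !σ v) ≤
      rootedSum ends φ α {y} fun _ => f := by
  have hinv : Function.Involutive fun (ω : V → Bool) v => !ω v := fun ω => by simp
  unfold rootedSum
  refine Finset.sum_le_sum fun η _ => mul_le_mul_of_nonneg_left ?_ (hφ η)
  have := Equiv.sum_comp hinv.toPerm fun ω : V → Bool =>
    bernoulliWeight (1 - α) ω * f fun v => !rootedSpin ends {y} η ω v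
  simp only [Function.Involutive.coe_toPerm, bernoulliWeight_not] at this
  rw [← this]
  refine Finset.sum_le_sum fun ω _ => mul_le_mul_of_nonneg_left (hf fun v => ?_)
    (bernoulliWeight_nonneg h0 h1 ω)
  simp only [rootedSpin]
  split_ifs <;> simp

theorem freeAssociated (ends : E → Sym2 V) (n : ℕ) :
    ∀ D : Set V, Dᶜ.ncard ≤ n → FreeAssociated V E ends D := by
  induction n using Nat.strong_induction_on with
  | _ n ih =>
  intro D hn φ α h0 h1 hφ f g hf hg hfD hgD
  by_cases hD : D = Set.univ
  · have hfc : f = fun _ => f ⊥ := funext fun σ => hfD _ _ fun v hv => (hv (hD ▸ trivial)).elim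
    have hgc : g = fun _ => g ⊥ := funext fun σ => hgD _ _ fun v hv => (hv (hD ▸ trivial)).elim
    rw [hfc, hgc]
    simp only [rootedSum, ← Finset.sum_mul, sum_bernoulliWeight]
    exact le_of_eq (by ring)
  obtain ⟨y, hy⟩ := (Set.ne_univ_iff_exists_notMem D).1 hD
  have hfree : ∀ R', {y} ⊆ R' → FreeAssociated V E ends (D ∪ R') := by
    intro R' hR'
    have : (D ∪ R')ᶜ.ncard < Dᶜ.ncard := by
      refine Set.ncard_lt_ncard ⟨Set.compl_subset_compl.2 Set.subset_union_left, fun hc => ?_⟩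
        (Set.toFinite _)
      exact hc hy (Or.inr (hR' rfl))
    exact ih _ (by omega) _ le_rfl
  have hloc : ∀ {k : (V → Bool) → ℝ}, Monotone k →
      (∀ σ τ, (∀ v, v ∉ D → σ v = τ v) → k σ = k τ) → IsRootLocal ends D {y} fun _ => k :=
    fun hk hkD => ⟨fun _ _ _ _ => le_rfl, fun _ => hk, fun _ => hkD, fun _ _ _ _ _ _ _ => rfl⟩
  have hflip : ∀ {k : (V → Bool) → ℝ}, Monotone k → Monotone fun σ : V → Bool => -k fun v => !σ v := by
    intro k hk σ τ h
    refine neg_le_neg (hk fun v => ?_)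
    have := h v
    revert this
    cases σ v <;> cases τ v <;> simp
  have hplus := rootedSum_mul_le _ {y} hfree φ α h0 h1 hφ le_rfl _ _ (hloc hf hfD) (hloc hg hgD)
  have hminus := rootedSum_mul_le _ {y} hfree φ (1 - α) (by linarith) (by linarith) hφ le_rfl _ _
    (hloc (hflip hf) fun σ τ h => by rw [hfD _ (fun v => !τ v) fun v hv => by simp [h v hv]])
    (hloc (hflip hg) fun σ τ h => by rw [hgD _ (fun v => !τ v) fun v hv => by simp [h v hv]])
  have hneg : ∀ k : (V → Bool) → ℝ, rootedSum ends φ (1 - α) {y} (fun _ σ => -k fun v => !σ v) =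
      -rootedSum ends φ (1 - α) {y} fun _ σ => k fun v => !σ v := by
    intro k
    simp [rootedSum]
  simp only [hneg, neg_mul_neg] at hminus
  have hfle := rootedSum_not_le (ends := ends) h0 h1 hφ.nonneg y hf
  have hgle := rootedSum_not_le (ends := ends) h0 h1 hφ.nonneg y hg
  rw [rootedSum_empty_eq ends φ α y f, rootedSum_empty_eq ends φ α y g,
    rootedSum_empty_eq ends φ α y fun σ => f σ * g σ]
  have h1' : 0 ≤ 1 - α := by linarith
  have k1 := mul_nonneg (mul_nonneg h0 h1')
    (mul_nonneg (sub_nonneg.2 hfle) (sub_nonneg.2 hgle))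
  have k2 := mul_le_mul_of_nonneg_left hplus h0
  have k3 := mul_le_mul_of_nonneg_left hminus h1'
  linarith

omit [Fintype E] [DecidableEq E] in
theorem natCard_component_subtype (ends : E → Sym2 V) (η : E → Bool) (σ : V → Bool) (b : Bool)
    (h : ∀ u v : V, (openSub ends η).Reachable u v → σ u = σ v) :
    Nat.card {K : (openSub ends η).ConnectedComponent //
      ∃ v, (openSub ends η).connectedComponentMk v = K ∧ σ v = b} =
      #{v | clusterRep ends η v = v ∧ σ v = b} := by
  rw [← Fintype.card_subtype, ← Nat.card_eq_fintype_card]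
  symm
  refine Nat.card_congr (Equiv.ofBijective
    (fun v => ⟨(openSub ends η).connectedComponentMk v.1, v.1, rfl, v.2.2⟩) ⟨?_, ?_⟩)
  · rintro ⟨v, hv, _⟩ ⟨w, hw, _⟩ hvw
    have := SimpleGraph.ConnectedComponent.exact (congrArg Subtype.val hvw)
    exact Subtype.ext (hv.symm.trans ((clusterRep_eq_iff.2 this).trans hw))
  · rintro ⟨K, v, rfl, hv⟩
    have hr := reachable_clusterRep ends η v
    refine ⟨⟨clusterRep ends η v, clusterRep_eq_iff.2 hr.symm, (h _ _ hr).symm.trans hv⟩, ?_⟩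
    ext1
    exact SimpleGraph.ConnectedComponent.sound hr.symm

omit [Fintype E] [DecidableEq E] in
theorem colorWeight_eq_sum (ends : E → Sym2 V) (α : ℝ) (η : E → Bool) (σ : V → Bool) :
    colorWeight ends α η σ =
      ∑ ω, bernoulliWeight α ω * if rootedSpin ends ∅ η ω = σ then 1 else 0 := by
  simp only [rootedSpin_empty]
  unfold colorWeight
  split_ifs with h
  · rw [natCard_component_subtype ends η σ true h, natCard_component_subtype ends η σ false h]
    have hiff : ∀ ω : V → Bool, (fun v => ω (clusterRep ends η v)) = σ ↔
        ∀ v, clusterRep ends η v = v → ω v = σ v := by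
      intro ω
      constructor
      · rintro rfl v hv
        simp only [hv]
      · intro hω
        funext v
        have hr := reachable_clusterRep ends η v
        rw [hω _ (clusterRep_eq_iff.2 hr.symm), ← h _ _ hr]
    have hprod : ∀ ω : V → Bool,
        (bernoulliWeight α ω * if (fun v => ω (clusterRep ends η v)) = σ then 1 else 0) =
        ∏ v, (if ω v = true then α else 1 - α) *
          if clusterRep ends η v = v → ω v = σ v then 1 else 0 := by
      intro ω
      rw [Finset.prod_mul_distrib, Finset.prod_ite_zero]
      simp [bernoulliWeight, hiff]
    simp only [hprod]
    rw [sum_prod_bool fun v b => (if b = true then α else 1 - α) *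
      if clusterRep ends η v = v → b = σ v then 1 else 0]
    rw [← Finset.prod_const, ← Finset.prod_const, Finset.prod_filter, Finset.prod_filter,
      ← Finset.prod_mul_distrib]
    refine Finset.prod_congr rfl fun v _ => ?_
    by_cases hv : clusterRep ends η v = v <;> cases hσ : σ v <;> simp [hv]
  · symm
    refine Finset.sum_eq_zero fun ω _ => ?_
    rw [if_neg, mul_zero]
    rintro rfl
    exact h fun u v huv => congrArg ω (clusterRep_eq_iff.2 huv)

theorem sum_colorWeight_eq_rootedSum (ends : E → Sym2 V) (φ : (E → Bool) → ℝ) (α : ℝ)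
    (A : Set (V → Bool)) [DecidablePred fun σ => σ ∈ A] :
    ∑ σ ∈ Finset.univ.filter (fun σ : V → Bool => σ ∈ A), ∑ η, φ η * colorWeight ends α η σ =
      rootedSum ends φ α ∅ fun _ σ => if σ ∈ A then 1 else 0 := by
  rw [Finset.sum_comm]
  refine Finset.sum_congr rfl fun η _ => ?_
  rw [← Finset.mul_sum]
  congr 1
  simp only [colorWeight_eq_sum]
  rw [Finset.sum_comm]
  refine Finset.sum_congr rfl fun ω _ => ?_
  rw [← Finset.mul_sum]
  congr 1
  simp

end ClusterColoring

/-- If `φ` is any probability measure on `{0,1}^E` satisfying the positive lattice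
condition and the factorization property across vertex cuts, then the associated
cluster-coloring measure `ν_{φ,α}` is positively associated. -/
theorem stmt_14 {V E : Type*} [Fintype V] [Fintype E] [DecidableEq V] [DecidableEq E]
    (ends : E → Sym2 V) (φ : (E → Bool) → ℝ) (α : ℝ) (hα : 0 < α ∧ α < 1)
    (hnn : ∀ η, 0 ≤ φ η) (hsum : ∑ η, φ η = 1)
    -- (i) positive lattice condition
    (hplc : ∀ η τ : E → Bool, φ η * φ τ ≤ φ (η ⊓ τ) * φ (η ⊔ τ))
    -- (ii) factorization: conditioned on all `S`–`Sᶜ` edges being closed, the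
    -- restrictions to the edges inside `S` and inside `Sᶜ` are independent
    (hfact : ∀ S : Set V,
      ∀ σ : {f : E // ∀ v ∈ ends f, v ∈ S} → Bool,
      ∀ τ : {f : E // ∀ v ∈ ends f, v ∉ S} → Bool,
      (∑ η ∈ Finset.univ.filter (fun η : E → Bool =>
          (∀ f, (¬ ∀ v ∈ ends f, v ∈ S) → (¬ ∀ v ∈ ends f, v ∉ S) → η f = false) ∧
          (∀ f, η f.1 = σ f) ∧ (∀ f, η f.1 = τ f)), φ η) *
        (∑ η ∈ Finset.univ.filter (fun η : E → Bool =>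
          ∀ f, (¬ ∀ v ∈ ends f, v ∈ S) → (¬ ∀ v ∈ ends f, v ∉ S) → η f = false), φ η) =
      (∑ η ∈ Finset.univ.filter (fun η : E → Bool =>
          (∀ f, (¬ ∀ v ∈ ends f, v ∈ S) → (¬ ∀ v ∈ ends f, v ∉ S) → η f = false) ∧
          (∀ f, η f.1 = σ f)), φ η) *
        (∑ η ∈ Finset.univ.filter (fun η : E → Bool =>
          (∀ f, (¬ ∀ v ∈ ends f, v ∈ S) → (¬ ∀ v ∈ ends f, v ∉ S) → η f = false) ∧
          (∀ f, η f.1 = τ f)), φ η))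
    (A B : Set (V → Bool))
    (hA : ∀ σ τ : V → Bool, σ ≤ τ → σ ∈ A → τ ∈ A)
    (hB : ∀ σ τ : V → Bool, σ ≤ τ → σ ∈ B → τ ∈ B) :
    (∑ σ ∈ Finset.univ.filter (fun σ : V → Bool => σ ∈ A ∩ B),
        ∑ η : E → Bool, φ η * colorWeight ends α η σ) ≥
      (∑ σ ∈ Finset.univ.filter (fun σ : V → Bool => σ ∈ A),
        ∑ η : E → Bool, φ η * colorWeight ends α η σ) *
        (∑ σ ∈ Finset.univ.filter (fun σ : V → Bool => σ ∈ B),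
          ∑ η : E → Bool, φ η * colorWeight ends α η σ) := by
  have hφ : IsFactorizingLattice ends φ := by
    refine ⟨hnn, hplc, fun S η τ hη hτ => ?_⟩
    set Z := ∑ η ∈ Finset.univ.filter (fun η : E → Bool =>
      ∀ f, (¬ ∀ v ∈ ends f, v ∈ S) → (¬ ∀ v ∈ ends f, v ∉ S) → η f = false), φ η with hZ
    have hprod : ∃ a b : (E → Bool) → ℝ, ∀ ξ ζ, CutClosed ends S ξ → CutClosed ends S ζ →
        φ (splice ends S ξ ζ) * Z = a ξ * b ζ := by
      refine ⟨_, _, fun ξ ζ hξ hζ => Eq.trans ?_ (hfact S (fun f => ξ f.1) (fun f => ζ f.1))⟩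
      congr 1
      symm
      rw [Finset.sum_eq_single (splice ends S ξ ζ)]
      · intro χ hχ hne
        refine (hne (funext fun e => ?_)).elim
        obtain ⟨hc, h1, h2⟩ := (Finset.mem_filter.1 hχ).2
        by_cases he : ∀ v ∈ ends e, v ∈ S
        · exact (h1 ⟨e, he⟩).trans (if_pos he).symm
        · refine Eq.trans ?_ (if_neg he).symm
          by_cases he' : ∀ v ∈ ends e, v ∉ S
          · exact h2 ⟨e, he'⟩
          · rw [hc e he he', hζ e ⟨he, he'⟩]
      · intro hnot
        refine (hnot (Finset.mem_filter.2 ⟨Finset.mem_univ _, ?_, ?_, ?_⟩)).elim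
        · exact fun e h1 h2 => hξ.splice hζ e ⟨h1, h2⟩
        · exact fun e => if_pos e.2
        · exact fun e => if_neg fun h => not_inside_compl_of_inside h e.2
    obtain ⟨a, b, hab⟩ := hprod
    have hself : ∀ ξ, splice ends S ξ ξ = ξ := fun ξ => funext fun e => ite_self _
    have e1 := hab η η hη hη
    have e2 := hab τ τ hτ hτ
    have e3 := hab η τ hη hτ
    have e4 := hab τ η hτ hη
    rw [hself] at e1 e2
    by_cases hz : Z = 0
    · have hall : ∀ ξ, CutClosed ends S ξ → φ ξ = 0 := fun ξ hξ =>
        (Finset.sum_eq_zero_iff_of_nonneg fun ξ _ => hnn ξ).1 (hZ.symm.trans hz) ξ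
          (Finset.mem_filter.2 ⟨Finset.mem_univ _, fun e h1 h2 => hξ e ⟨h1, h2⟩⟩)
      rw [hall η hη, hall _ (hη.splice hτ), zero_mul, zero_mul]
    · refine mul_right_cancel₀ (mul_ne_zero hz hz) ?_
      calc φ η * φ τ * (Z * Z) = (φ η * Z) * (φ τ * Z) := by ring
        _ = (φ (splice ends S η τ) * Z) * (φ (splice ends S τ η) * Z) := by
          rw [e1, e2, e3, e4]; ring
        _ = _ := by ring
  have hind : ∀ C : Set (V → Bool), (∀ σ τ : V → Bool, σ ≤ τ → σ ∈ C → τ ∈ C) →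
      Monotone fun σ => if σ ∈ C then (1 : ℝ) else 0 := by
    intro C hC σ τ hle
    by_cases h1 : σ ∈ C
    · simp [h1, hC σ τ hle h1]
    · by_cases h2 : τ ∈ C <;> simp [h1, h2]
  have key := freeAssociated ends _ ∅ le_rfl φ α hα.1.le hα.2.le hφ _ _ (hind A hA) (hind B hB)
    (fun σ τ h => by rw [funext fun v => h v (Set.notMem_empty v)])
    (fun σ τ h => by rw [funext fun v => h v (Set.notMem_empty v)])
  rw [hsum, one_mul] at key
  rw [sum_colorWeight_eq_rootedSum, sum_colorWeight_eq_rootedSum, sum_colorWeight_eq_rootedSum]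
  refine key.trans (le_of_eq ?_)
  congr 1
  funext _ σ
  by_cases h1 : σ ∈ A <;> by_cases h2 : σ ∈ B <;> simp [h1, h2]
end
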